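/- arXiv:2109.02130 — 5 statements merged into one kernel-verified Lean document; each statement's English description precedes it below -/
import Mathlib

section
/- Let f ∈ ℤ[x] be a monic squarefree polynomial of degree n and let A, B ∈ ℤ^{n×n} both have characteristic polynomial f. If A and B are ℤ_p-conjugate for every prime p for which the reduction of f modulo p is not squarefree in 𝔽_p[x], then A and B are ℤ_p-conjugate for every prime p (i.e., A and B are locally conjugate). -/
open Polynomial in
theorem aux_det_zero {K : Type*} [Field K] {n : ℕ} (A : Matrix (Fin n) (Fin n) K) (g : K[X])
    (hg : Irreducible g) (hd : g ∣ A.charpoly) : (aeval A g).det = 0 := by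
  haveI : Fact (Irreducible g) := ⟨hg⟩
  let φ : K →+* AdjoinRoot g := AdjoinRoot.of g
  apply φ.injective
  rw [map_zero, RingHom.map_det]
  have h1 : φ.mapMatrix (aeval A g) = aeval (φ.mapMatrix A) (g.map φ) := by
    have := Polynomial.hom_eval₂ g (algebraMap K (Matrix (Fin n) (Fin n) K)) φ.mapMatrix A
    rw [aeval_def, this, aeval_def, eval₂_map]
    congr 1
    ext a i j
    simp [Matrix.algebraMap_matrix_apply]
    split_ifs <;> simp
  have h2 : (X - C (AdjoinRoot.root g)) ∣ g.map φ := by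
    rw [dvd_iff_isRoot]
    exact AdjoinRoot.isRoot_root g
  obtain ⟨q, hq⟩ := h2
  have h3 : (A.charpoly.map φ).eval (AdjoinRoot.root g) = 0 := by
    obtain ⟨r, hr⟩ := hd
    rw [hr, Polynomial.map_mul, eval_mul, (AdjoinRoot.isRoot_root g : _ = _), zero_mul]
  rw [← Matrix.charpoly_map, Matrix.eval_charpoly] at h3
  rw [h1, hq, map_mul, Matrix.det_mul]
  have : aeval (φ.mapMatrix A) (X - C (AdjoinRoot.root g)) =
      -(Matrix.scalar (Fin n) (AdjoinRoot.root g) - A.map φ) := by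
    simp [Matrix.algebraMap_eq_diagonal]
  rw [this, Matrix.det_neg, h3]
  simp

open Polynomial in
theorem aux_cyclic {K : Type*} [Field K] {n : ℕ} (A : Matrix (Fin n) (Fin n) K) (q : K[X]) :
    Squarefree q → q ∣ A.charpoly → ∃ v : Fin n → K,
      (aeval A q).mulVec v = 0 ∧ ∀ h : K[X], (aeval A h).mulVec v = 0 → q ∣ h := by
  induction q using UniqueFactorizationMonoid.induction_on_prime with
  | h₁ => intro h; exact absurd h not_squarefree_zero
  | h₂ x hx => intro _ _; exact ⟨0, by simp, fun h _ => hx.dvd⟩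
  | h₃ a p ha hp ih =>
    intro hs hd
    obtain ⟨v, hv0, hv⟩ := ih (hs.squarefree_of_dvd (dvd_mul_left _ _))
      ((dvd_mul_left _ _).trans hd)
    have hpd : p ∣ A.charpoly := (dvd_mul_right _ _).trans hd
    obtain ⟨w, hw, hw0⟩ := Matrix.exists_mulVec_eq_zero_iff.mpr
      (aux_det_zero A p hp.irreducible hpd)
    have hcop : IsCoprime p a := by
      rw [hp.irreducible.coprime_iff_not_dvd]
      rintro ⟨b, rfl⟩
      exact hp.not_unit (hs p ⟨b, by ring⟩)
    have hwd : ∀ h : K[X], (aeval A h).mulVec w = 0 → p ∣ h := by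
      intro h hh
      by_contra hnd
      obtain ⟨s, t, hst⟩ := hp.irreducible.coprime_iff_not_dvd.mpr hnd
      apply hw
      have := congrArg (fun r => (aeval A r).mulVec w) hst
      simpa [map_add, map_mul, Matrix.add_mulVec, ← Matrix.mulVec_mulVec, hw0, hh] using this.symm
    refine ⟨v + w, ?_, ?_⟩
    · rw [Matrix.mulVec_add]
      nth_rewrite 2 [mul_comm]
      simp [map_mul, ← Matrix.mulVec_mulVec, hv0, hw0]
    · intro h hh
      apply hcop.mul_dvd
      · apply hcop.dvd_of_dvd_mul_left
        apply hwd
        have : (aeval A (h * a)).mulVec (v + w) = 0 := by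
          rw [mul_comm, map_mul, ← Matrix.mulVec_mulVec, hh, Matrix.mulVec_zero]
        rw [Matrix.mulVec_add, map_mul, ← Matrix.mulVec_mulVec, hv0] at this
        rw [mul_comm, map_mul]
        simpa using this
      · apply hcop.symm.dvd_of_dvd_mul_left
        apply hv
        have : (aeval A (h * p)).mulVec (v + w) = 0 := by
          rw [mul_comm, map_mul, ← Matrix.mulVec_mulVec, hh, Matrix.mulVec_zero]
        rw [Matrix.mulVec_add, map_mul, ← Matrix.mulVec_mulVec, ← Matrix.mulVec_mulVec, hw0] at this
        rw [mul_comm, map_mul, ← Matrix.mulVec_mulVec]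
        simpa using this

/-- Krylov matrix. -/
def auxP {R : Type*} [CommRing R] {n : ℕ} (A : Matrix (Fin n) (Fin n) R) (v : Fin n → R) :
    Matrix (Fin n) (Fin n) R := Matrix.of fun i j => (A ^ (j : ℕ)).mulVec v i

theorem auxP_map {R S : Type*} [CommRing R] [CommRing S] {n : ℕ} (φ : R →+* S)
    (A : Matrix (Fin n) (Fin n) R) (v : Fin n → R) :
    φ.mapMatrix (auxP A v) = auxP (φ.mapMatrix A) (φ ∘ v) := by
  ext i j
  simp only [auxP, RingHom.mapMatrix_apply, Matrix.map_apply, Matrix.of_apply]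
  rw [RingHom.map_mulVec, ← RingHom.mapMatrix_apply, map_pow]
  rfl

open Polynomial in
theorem auxP_companion {R : Type*} [CommRing R] [Nontrivial R] {n : ℕ}
    (A : Matrix (Fin n) (Fin n) R) (v : Fin n → R) :
    A * auxP A v = auxP A v * Matrix.of fun i j : Fin n =>
      (X ^ ((j : ℕ) + 1) %ₘ A.charpoly).coeff (i : ℕ) := by
  ext i j
  have hl : (A * auxP A v) i j = (A ^ ((j : ℕ) + 1)).mulVec v i := by
    rw [pow_succ', ← Matrix.mulVec_mulVec]
    rfl
  rw [hl, Matrix.pow_eq_aeval_mod_charpoly]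
  have hdeg : (X ^ ((j : ℕ) + 1) %ₘ A.charpoly).natDegree < n := by
    have := natDegree_modByMonic_lt (X ^ ((j : ℕ) + 1)) A.charpoly_monic (by
      intro h
      have := A.charpoly_natDegree_eq_dim
      rw [h] at this
      have hj := j.2
      simp at this
      omega)
    simpa using this
  rw [aeval_eq_sum_range' hdeg, Matrix.sum_mulVec, Finset.sum_apply, Finset.sum_range,
    Matrix.mul_apply]
  refine Finset.sum_congr rfl fun k _ => ?_
  simp [auxP, Matrix.smul_mulVec, mul_comm]

open Polynomial in
theorem aux_det_ne {K : Type*} [Field K] {n : ℕ} (A : Matrix (Fin n) (Fin n) K)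
    (hs : Squarefree A.charpoly) : ∃ v : Fin n → K, (auxP A v).det ≠ 0 := by
  obtain ⟨v, -, hv⟩ := aux_cyclic A _ hs dvd_rfl
  refine ⟨v, fun h0 => ?_⟩
  obtain ⟨w, hw, hw0⟩ := Matrix.exists_mulVec_eq_zero_iff.mpr h0
  apply hw
  let h : K[X] := ∑ j : Fin n, monomial (j : ℕ) (w j)
  have hh : h = 0 := by
    have hd : h.degree < A.charpoly.degree := by
      rw [A.charpoly_degree_eq_dim, Fintype.card_fin]
      refine (degree_sum_le _ _).trans_lt ?_
      refine (Finset.sup_lt_iff (WithBot.bot_lt_coe n)).mpr ?_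
      intro j _
      exact (degree_monomial_le _ _).trans_lt (WithBot.coe_lt_coe.mpr j.2)
    refine eq_zero_of_dvd_of_degree_lt (hv h ?_) hd
    rw [← hw0]
    ext i
    rw [map_sum, Matrix.sum_mulVec, Finset.sum_apply]
    refine Finset.sum_congr rfl fun k _ => ?_
    rw [aeval_monomial, ← Algebra.smul_def, Matrix.smul_mulVec]
    simp [auxP, mul_comm]
  ext j
  have := congrArg (fun r => coeff r (j : ℕ)) hh
  simpa [h, finset_sum_coeff, coeff_monomial, Fin.val_inj] using this

theorem aux_int {n : ℕ} (p : ℕ) [Fact p.Prime] (A : Matrix (Fin n) (Fin n) ℤ)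
    (hs : Squarefree (A.charpoly.map (Int.castRingHom (ZMod p)))) :
    ∃ v : Fin n → ℤ, IsUnit ((auxP A v).map (Int.cast : ℤ → ℤ_[p])).det := by
  rw [← Matrix.charpoly_map] at hs
  obtain ⟨v, hv⟩ := aux_det_ne _ hs
  choose u hu using fun i => ZMod.intCast_surjective (v i)
  refine ⟨u, ?_⟩
  have e : v = (Int.castRingHom (ZMod p)) ∘ u := by
    ext i; simp [hu]
  rw [e, ← RingHom.mapMatrix_apply, ← auxP_map, ← RingHom.map_det] at hv
  have : ((auxP A u).map (Int.cast : ℤ → ℤ_[p])).det = (((auxP A u).det : ℤ) : ℤ_[p]) :=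
    (RingHom.map_det (Int.castRingHom ℤ_[p]) (auxP A u)).symm
  rw [this, PadicInt.isUnit_iff]
  have h1 := PadicInt.norm_le_one (((auxP A u).det : ℤ) : ℤ_[p])
  refine le_antisymm h1 (not_lt.mp fun hlt => hv ?_)
  rw [PadicInt.norm_intCast_lt_one_iff] at hlt
  exact (ZMod.intCast_zmod_eq_zero_iff_dvd _ _).mpr hlt

/-- If `f ∈ ℤ[x]` is monic squarefree of degree `n`, `A, B ∈ ℤ^{n×n}` both have
characteristic polynomial `f`, and `A` and `B` are `ℤ_p`-conjugate for every prime `p` for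
which the reduction of `f` mod `p` is not squarefree, then `A` and `B` are `ℤ_p`-conjugate
for every prime `p` (locally conjugate). -/
theorem locally_conjugate_of_conjugate_at_bad_primes
    (n : ℕ) (f : Polynomial ℤ) (hmonic : f.Monic) (hsf : Squarefree f)
    (hdeg : f.natDegree = n)
    (A B : Matrix (Fin n) (Fin n) ℤ)
    (hA : A.charpoly = f) (hB : B.charpoly = f)
    (h : ∀ (p : ℕ) [Fact p.Prime], ¬ Squarefree (f.map (Int.castRingHom (ZMod p))) →
      ∃ C : Matrix (Fin n) (Fin n) ℤ_[p],
        IsUnit C.det ∧ A.map (Int.cast : ℤ → ℤ_[p]) * C = C * B.map (Int.cast : ℤ → ℤ_[p])) :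
    ∀ (p : ℕ) [Fact p.Prime],
      ∃ C : Matrix (Fin n) (Fin n) ℤ_[p],
        IsUnit C.det ∧ A.map (Int.cast : ℤ → ℤ_[p]) * C = C * B.map (Int.cast : ℤ → ℤ_[p]) := by
  intro p hp
  by_cases hs : Squarefree (f.map (Int.castRingHom (ZMod p)))
  swap
  · exact h p hs
  obtain ⟨v, hv⟩ := aux_int p A (hA ▸ hs)
  obtain ⟨w, hw⟩ := aux_int p B (hB ▸ hs)
  have cA := congrArg (Int.castRingHom ℤ_[p]).mapMatrix (auxP_companion A v)
  have cB := congrArg (Int.castRingHom ℤ_[p]).mapMatrix (auxP_companion B w)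
  rw [hA, map_mul, map_mul] at cA
  rw [hB, map_mul, map_mul] at cB
  generalize (Int.castRingHom ℤ_[p]).mapMatrix (Matrix.of fun i j : Fin n =>
      (Polynomial.X ^ ((j : ℕ) + 1) %ₘ f).coeff (i : ℕ)) = T at cA cB
  change A.map (Int.cast : ℤ → ℤ_[p]) * (auxP A v).map (Int.cast : ℤ → ℤ_[p]) =
    (auxP A v).map (Int.cast : ℤ → ℤ_[p]) * T at cA
  change B.map (Int.cast : ℤ → ℤ_[p]) * (auxP B w).map (Int.cast : ℤ → ℤ_[p]) =
    (auxP B w).map (Int.cast : ℤ → ℤ_[p]) * T at cB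
  generalize (auxP A v).map (Int.cast : ℤ → ℤ_[p]) = P at *
  generalize (auxP B w).map (Int.cast : ℤ → ℤ_[p]) = Q at *
  refine ⟨P * Q⁻¹, ?_, ?_⟩
  · rw [Matrix.det_mul]
    exact hv.mul (Matrix.isUnit_nonsing_inv_det Q hw)
  · have : T * Q⁻¹ = Q⁻¹ * B.map (Int.cast : ℤ → ℤ_[p]) := by
      calc T * Q⁻¹ = Q⁻¹ * (Q * T) * Q⁻¹ := by
            rw [← mul_assoc, Matrix.nonsing_inv_mul Q hw, one_mul]
        _ = _ := by
            rw [← cB, mul_assoc, mul_assoc, Matrix.mul_nonsing_inv Q hw, mul_one]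
    rw [← mul_assoc, cA, mul_assoc, this, mul_assoc]
end

section
/- Let F be a field, let f ∈ F[x] be a monic squarefree polynomial of degree n, and let A, B ∈ F^{n×n} both have characteristic polynomial f. Then the F-vector space {X ∈ F^{n×n} : A·X = X·B} of solutions to the Sylvester equation has dimension exactly n; equivalently, the F-linear map T(X) = A·X − X·B on F^{n×n} has rank n² − n. -/
open Polynomial in
theorem syl_irred {F : Type*} [Field F] {n : ℕ} (B : Matrix (Fin n) (Fin n) F) (p : F[X])
    (hp : Irreducible p) (hd : p ∣ B.charpoly) :
    ∃ v : Fin n → F, ∀ q : F[X], (aeval B q).mulVec v = 0 ↔ p ∣ q := by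
  obtain ⟨α, hα⟩ := IsAlgClosed.exists_aeval_eq_zero (AlgebraicClosure F) p
    (Polynomial.degree_pos_of_irreducible hp).ne'
  have hroot : (B.map (algebraMap F (AlgebraicClosure F))).charpoly.eval α = 0 := by
    rw [Matrix.charpoly_map, eval_map_algebraMap]
    exact aeval_eq_zero_of_dvd_aeval_eq_zero hd hα
  rw [Matrix.eval_charpoly] at hroot
  obtain ⟨w, hw0, hw⟩ := Matrix.exists_mulVec_eq_zero_iff.mpr hroot
  have hw' : (B.map (algebraMap F (AlgebraicClosure F))).mulVec w = α • w := by
    rw [Matrix.sub_mulVec, sub_eq_zero] at hw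
    rw [← hw, Matrix.scalar_apply, ← Matrix.smul_one_eq_diagonal, Matrix.smul_mulVec,
      Matrix.one_mulVec]
  have key : ∀ q : F[X], (aeval (B.map (algebraMap F (AlgebraicClosure F))) q).mulVec w
      = (aeval α q) • w := by
    intro q
    induction q using Polynomial.induction_on' with
    | add a b ha hb => simp [Matrix.add_mulVec, ha, hb, add_smul]
    | monomial k a =>
      have : ((B.map (algebraMap F (AlgebraicClosure F))) ^ k).mulVec w = α ^ k • w := by
        induction k with
        | zero => simp
        | succ k ih =>
          rw [pow_succ, ← Matrix.mulVec_mulVec, hw', Matrix.mulVec_smul, ih, smul_smul, pow_succ,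
            mul_comm]
      simp only [aeval_monomial, ← Algebra.smul_def, Matrix.smul_mulVec, this, smul_assoc]
  have hdet : (aeval B p).det = 0 := by
    apply (algebraMap F (AlgebraicClosure F)).injective
    rw [RingHom.map_det, map_zero]
    apply Matrix.exists_mulVec_eq_zero_iff.mp
    refine ⟨w, hw0, ?_⟩
    have h1 : (algebraMap F (AlgebraicClosure F)).mapMatrix (aeval B p)
        = aeval (B.map (algebraMap F (AlgebraicClosure F))) p :=
      (Polynomial.aeval_algHom_apply (Algebra.ofId F (AlgebraicClosure F)).mapMatrix B p).symm
    rw [h1, key, hα, zero_smul]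
  obtain ⟨v, hv0, hv⟩ := Matrix.exists_mulVec_eq_zero_iff.mpr hdet
  refine ⟨v, fun q => ⟨fun hq => ?_, ?_⟩⟩
  · by_contra hnd
    obtain ⟨a, b, hab⟩ := (hp.coprime_iff_not_dvd).mpr hnd
    apply hv0
    have := congrArg (fun r => (aeval B r).mulVec v) hab
    simpa [Matrix.add_mulVec, ← Matrix.mulVec_mulVec, hv, hq] using this.symm
  · rintro ⟨r, rfl⟩
    rw [mul_comm, map_mul, ← Matrix.mulVec_mulVec, hv, Matrix.mulVec_zero]

open Polynomial in
theorem syl_cyclic {F : Type*} [Field F] {n : ℕ} (B : Matrix (Fin n) (Fin n) F) (g : F[X]) :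
    Squarefree g → g ∣ B.charpoly →
    ∃ v : Fin n → F, ∀ q : F[X], (aeval B q).mulVec v = 0 ↔ g ∣ q := by
  induction g using UniqueFactorizationMonoid.induction_on_coprime with
  | h0 => intro h; exact absurd h not_squarefree_zero
  | h1 hx =>
    intro _ _
    exact ⟨0, fun q => by simp [hx.dvd]⟩
  | hpr i hp =>
    rename_i p
    intro hs hd
    by_cases hu : IsUnit (p ^ i)
    · exact ⟨0, fun q => by simp [hu.dvd]⟩
    have hi : i = 1 := by
      by_contra h1
      have h0 : i ≠ 0 := by rintro rfl; simp at hu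
      exact hp.not_isUnit (hs p (by rw [← pow_two]; exact pow_dvd_pow _ (by omega)))
    subst hi
    rw [pow_one] at hd ⊢
    exact syl_irred B p hp.irreducible hd
  | hcp hxy iha ihb =>
    replace hxy := hxy.isCoprime
    rename_i a b
    intro hs hd
    obtain ⟨va, hva⟩ := iha (hs.squarefree_of_dvd (dvd_mul_right a b))
      ((dvd_mul_right a b).trans hd)
    obtain ⟨vb, hvb⟩ := ihb (hs.squarefree_of_dvd (dvd_mul_left b a))
      ((dvd_mul_left b a).trans hd)
    refine ⟨va + vb, fun q => ⟨fun hq => ?_, fun hq => ?_⟩⟩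
    · have h : ∀ r : F[X], (aeval B (r * q)).mulVec va + (aeval B (r * q)).mulVec vb = 0 := by
        intro r
        rw [← Matrix.mulVec_add, map_mul, ← Matrix.mulVec_mulVec, hq, Matrix.mulVec_zero]
      refine hxy.mul_dvd ?_ ?_
      · have := h b
        rw [(hvb _).mpr (dvd_mul_right b q), add_zero, hva] at this
        exact hxy.dvd_of_dvd_mul_left this
      · have := h a
        rw [(hva _).mpr (dvd_mul_right a q), zero_add, hvb] at this
        exact hxy.symm.dvd_of_dvd_mul_left this
    · rw [Matrix.mulVec_add, (hva q).mpr ((dvd_mul_right a b).trans hq),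
        (hvb q).mpr ((dvd_mul_left b a).trans hq), add_zero]

open Polynomial in
/-- The map `q ↦ q(B) v`. -/
noncomputable def sylEv {F : Type*} [Field F] {n : ℕ} (B : Matrix (Fin n) (Fin n) F)
    (v : Fin n → F) : F[X] →ₗ[F] (Fin n → F) where
  toFun q := (aeval B q).mulVec v
  map_add' a b := by simp [Matrix.add_mulVec]
  map_smul' a b := by simp [Matrix.smul_mulVec]

open Polynomial in
theorem syl_surj {F : Type*} [Field F] {n : ℕ} (B : Matrix (Fin n) (Fin n) F)
    (v : Fin n → F) (h : ∀ q : F[X], (aeval B q).mulVec v = 0 ↔ B.charpoly ∣ q) :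
    Function.Surjective (sylEv B v) := by
  have hinj : Function.Injective
      ((sylEv B v ∘ₗ (degreeLT F n).subtype) ∘ₗ (degreeLTEquiv F n).symm.toLinearMap) := by
    rw [LinearMap.coe_comp]
    refine Function.Injective.comp ?_ (degreeLTEquiv F n).symm.injective
    rw [← LinearMap.ker_eq_bot, LinearMap.ker_eq_bot']
    rintro ⟨q, hq⟩ h0
    have h1 : B.charpoly ∣ q := (h q).mp h0
    have : q = 0 := by
      refine Polynomial.eq_zero_of_dvd_of_degree_lt h1 ?_
      rw [Matrix.charpoly_degree_eq_dim, Fintype.card_fin]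
      exact mem_degreeLT.mp hq
    exact Subtype.ext this
  have hs := LinearMap.injective_iff_surjective.mp hinj
  intro u
  obtain ⟨x, hx⟩ := hs u
  exact ⟨_, hx⟩

open Polynomial in
theorem syl_intertwine {F : Type*} [Field F] {n : ℕ} {A B M : Matrix (Fin n) (Fin n) F}
    (h : A * M = M * B) (q : F[X]) : aeval A q * M = M * aeval B q := by
  induction q using Polynomial.induction_on' with
  | add a b ha hb => simp [add_mul, mul_add, ha, hb]
  | monomial k a =>
    have : A ^ k * M = M * B ^ k :=
      ((show SemiconjBy M B A from h.symm).pow_right k).symm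
    simp only [aeval_monomial, ← Algebra.smul_def, smul_mul_assoc, mul_smul_comm, this]

/-- Over a field `F`, if `f` is monic squarefree of degree `n` and `A, B` both
have characteristic polynomial `f`, then the solution space `{X : A·X = X·B}` of the
Sylvester equation has dimension exactly `n`. -/
theorem sylvester_kernel_dim_eq_degree
    (F : Type*) [Field F] (n : ℕ) (f : Polynomial F) (hmonic : f.Monic)
    (hsf : Squarefree f) (hdeg : f.natDegree = n)
    (A B : Matrix (Fin n) (Fin n) F)
    (hA : A.charpoly = f) (hB : B.charpoly = f) :
    Module.finrank F
      ↥(LinearMap.ker (LinearMap.mulLeft F A - LinearMap.mulRight F B)) = n := by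
  obtain ⟨v, hv⟩ := syl_cyclic B f hsf (by rw [hB])
  have hsurj := syl_surj B v (by rw [hB]; exact hv)
  have hmem : ∀ M : Matrix (Fin n) (Fin n) F,
      M ∈ LinearMap.ker (LinearMap.mulLeft F A - LinearMap.mulRight F B) ↔ A * M = M * B := by
    intro M
    simp [LinearMap.mem_ker, sub_eq_zero]
  let E : Matrix (Fin n) (Fin n) F →ₗ[F] (Fin n → F) :=
    { toFun := fun M => M.mulVec v
      map_add' := fun a b => Matrix.add_mulVec a b v
      map_smul' := fun a b => by simp [Matrix.smul_mulVec] }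
  let E' := E ∘ₗ (LinearMap.ker (LinearMap.mulLeft F A - LinearMap.mulRight F B)).subtype
  have hbij : Function.Bijective E' := by
    constructor
    · rw [← LinearMap.ker_eq_bot, LinearMap.ker_eq_bot']
      rintro ⟨M, hM⟩ h0
      have h0' : M.mulVec v = 0 := h0
      rw [hmem] at hM
      refine Subtype.ext (Matrix.ext_of_mulVec_single fun i => ?_)
      obtain ⟨q, hq⟩ := hsurj (Pi.single i 1)
      have hq' : (Polynomial.aeval B q).mulVec v = Pi.single i 1 := hq
      simp only [← hq', Matrix.mulVec_mulVec, ← syl_intertwine hM]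
      rw [← Matrix.mulVec_mulVec, h0']
      simp
    · intro w
      obtain ⟨s, hs⟩ := LinearMap.exists_rightInverse_of_surjective (sylEv B v)
        (LinearMap.range_eq_top.mpr hsurj)
      have hs' : ∀ u, sylEv B v (s u) = u := fun u => LinearMap.congr_fun hs u
      have hX : ∀ q : Polynomial F, (LinearMap.toMatrix' (sylEv A w ∘ₗ s)).mulVec ((Polynomial.aeval B q).mulVec v)
          = (Polynomial.aeval A q).mulVec w := by
        intro q
        rw [LinearMap.toMatrix'_mulVec]
        change sylEv A w (s (sylEv B v q)) = sylEv A w q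
        rw [← sub_eq_zero, ← map_sub]
        have h1 : f ∣ s (sylEv B v q) - q := by
          apply (hv _).mp
          change sylEv B v _ = 0
          rw [map_sub, hs', sub_self]
        obtain ⟨r, hr⟩ := h1
        rw [hr]
        change (Polynomial.aeval A (f * r)).mulVec w = 0
        rw [map_mul, ← hA, Matrix.aeval_self_charpoly, zero_mul, Matrix.zero_mulVec]
      refine ⟨⟨LinearMap.toMatrix' (sylEv A w ∘ₗ s), ?_⟩, ?_⟩
      · rw [hmem]
        refine Matrix.ext_of_mulVec_single fun i => ?_
        obtain ⟨q, hq⟩ := hsurj (Pi.single i 1)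
        have hq' : (Polynomial.aeval B q).mulVec v = Pi.single i 1 := hq
        have h2 := hX (Polynomial.X * q)
        simp only [map_mul, Polynomial.aeval_X, ← Matrix.mulVec_mulVec] at h2
        rw [← hq', ← Matrix.mulVec_mulVec, ← Matrix.mulVec_mulVec, hX, h2]
      · have := hX 1
        rw [map_one, map_one, Matrix.one_mulVec, Matrix.one_mulVec] at this
        exact this
  rw [(LinearEquiv.ofBijective E' hbij).finrank_eq]
  simp
end

section
/- Let A, B ∈ ℤ^{n×n}. Then A and B are ℤ_p-conjugate for every prime p if and only if there exists a commutative integral domain R together with an injective ring homomorphism ℤ → R such that every element of R is integral over ℤ (i.e., R is an algebraic integral extension of ℤ) and A and B are R-conjugate, i.e., there exists C ∈ R^{n×n} with det C a unit of R and A·C = C·B. -/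
open Polynomial

theorem aux_card_hom {S : Type} [Ring S] {V X : Type} [AddCommGroup V] [Module S V]
    [AddCommGroup X] [Module S X] [Finite V] [Finite X] :
    Nat.card (X →ₗ[S] V) =
      ∑ᶠ Y : Submodule S X, Nat.card {f : (X ⧸ Y) →ₗ[S] V // Function.Injective f} := by
  classical
  have : Finite (X →ₗ[S] V) := DFunLike.finite _
  have : Fintype (Submodule S X) := Fintype.ofFinite _
  rw [finsum_eq_sum_of_fintype]
  have h1 : Nat.card (X →ₗ[S] V) =
      Nat.card (Σ Y : Submodule S X, {f : (X ⧸ Y) →ₗ[S] V // Function.Injective f}) := by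
    symm
    apply Nat.card_congr
    refine Equiv.ofBijective (fun a => a.2.1 ∘ₗ a.1.mkQ) ⟨?_, ?_⟩
    · rintro ⟨Y, f, hf⟩ ⟨Z, g, hg⟩ h
      have hY : LinearMap.ker (f ∘ₗ Y.mkQ) = Y := by
        rw [LinearMap.ker_comp, LinearMap.ker_eq_bot.2 hf]; simp
      have hZ : LinearMap.ker (g ∘ₗ Z.mkQ) = Z := by
        rw [LinearMap.ker_comp, LinearMap.ker_eq_bot.2 hg]; simp
      dsimp only at h
      have : Y = Z := by rw [← hY, h, hZ]
      subst this
      have : f = g := by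
        ext x
        exact LinearMap.congr_fun h x
      subst this
      rfl
    · intro f
      refine ⟨⟨LinearMap.ker f, (LinearMap.ker f).liftQ f le_rfl, ?_⟩, ?_⟩
      · rw [← LinearMap.ker_eq_bot]
        exact Submodule.ker_liftQ_eq_bot _ _ _ le_rfl
      · ext x; rfl
  have : ∀ Y : Submodule S X, Finite {f : (X ⧸ Y) →ₗ[S] V // Function.Injective f} := by
    intro Y
    have : Finite (X ⧸ Y) := Quotient.finite _
    have : Finite ((X ⧸ Y) →ₗ[S] V) := DFunLike.finite _
    infer_instance
  rw [h1, Nat.card_sigma]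

theorem aux_inj_card {S : Type} [Ring S] {V W : Type} [AddCommGroup V] [Module S V]
    [AddCommGroup W] [Module S W] [Finite V] [Finite W]
    (h : ∀ (X : Type) [AddCommGroup X] [Module S X] [Finite X],
      Nat.card (X →ₗ[S] V) = Nat.card (X →ₗ[S] W)) :
    ∀ (k : ℕ) (X : Type) [AddCommGroup X] [Module S X] [Finite X], Nat.card X = k →
      Nat.card {f : X →ₗ[S] V // Function.Injective f} =
      Nat.card {f : X →ₗ[S] W // Function.Injective f} := by
  intro k
  induction k using Nat.strong_induction_on with
  | _ k ih =>
  intro X _ _ _ hk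
  classical
  have : Fintype (Submodule S X) := Fintype.ofFinite _
  have hX := h X
  rw [aux_card_hom, aux_card_hom, finsum_eq_sum_of_fintype, finsum_eq_sum_of_fintype,
    ← Finset.add_sum_erase _ _ (Finset.mem_univ (⊥ : Submodule S X)),
    ← Finset.add_sum_erase _ _ (Finset.mem_univ (⊥ : Submodule S X))] at hX
  have h2 : ∀ Y ∈ (Finset.univ : Finset (Submodule S X)).erase ⊥,
      Nat.card {f : (X ⧸ Y) →ₗ[S] V // Function.Injective f} =
      Nat.card {f : (X ⧸ Y) →ₗ[S] W // Function.Injective f} := by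
    intro Y hY
    have hY' : Y ≠ ⊥ := (Finset.mem_erase.1 hY).1
    have : Finite (X ⧸ Y) := Quotient.finite _
    refine ih (Nat.card (X ⧸ Y)) ?_ _ rfl
    rw [← hk, Submodule.card_eq_card_quotient_mul_card Y]
    have : 1 < Nat.card Y := by
      rw [Finite.one_lt_card_iff_nontrivial]
      exact Submodule.nontrivial_iff_ne_bot.2 hY'
    have h0 : 0 < Nat.card (X ⧸ Y) := Nat.card_pos
    nlinarith
  rw [Finset.sum_congr rfl h2] at hX
  have h3 := Nat.add_right_cancel hX
  have e : ∀ (U : Type) [AddCommGroup U] [Module S U],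
      Nat.card {f : (X ⧸ (⊥ : Submodule S X)) →ₗ[S] U // Function.Injective f} =
      Nat.card {f : X →ₗ[S] U // Function.Injective f} := by
    intro U _ _
    apply Nat.card_congr
    let q := Submodule.quotEquivOfEqBot (⊥ : Submodule S X) rfl
    refine Equiv.subtypeEquiv (q.congrLeft U ℕ).toEquiv ?_
    intro f
    change Function.Injective f ↔ Function.Injective (fun x => f (q.symm x))
    exact (Function.Injective.of_comp_iff' f q.symm.bijective).symm
  rw [e, e] at h3
  exact h3

theorem aux_cancel {S : Type} [Ring S] {V W ι : Type} [AddCommGroup V] [Module S V]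
    [AddCommGroup W] [Module S W] [Finite V] [Finite W] [Finite ι] [Nonempty ι]
    (e : (ι → V) ≃ₗ[S] (ι → W)) : Nonempty (V ≃ₗ[S] W) := by
  have hι : Nat.card ι ≠ 0 := Nat.card_ne_zero.2 ⟨inferInstance, inferInstance⟩
  have : Fintype ι := Fintype.ofFinite _
  have key : ∀ (X : Type) [AddCommGroup X] [Module S X] [Finite X],
      Nat.card (X →ₗ[S] V) = Nat.card (X →ₗ[S] W) := by
    intro X _ _ _
    have hp : ∀ (U : Type) [AddCommGroup U] [Module S U],
        Nat.card (X →ₗ[S] (ι → U)) = Nat.card (X →ₗ[S] U) ^ Nat.card ι := by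
      intro U _ _
      rw [← Nat.card_fun]
      exact Nat.card_congr
        { toFun := fun f i => LinearMap.proj i ∘ₗ f
          invFun := fun f => LinearMap.pi f
          left_inv := fun f => rfl
          right_inv := fun f => rfl }
    have h1 : Nat.card (X →ₗ[S] (ι → V)) = Nat.card (X →ₗ[S] (ι → W)) :=
      Nat.card_congr
        { toFun := fun f => e.toLinearMap ∘ₗ f
          invFun := fun f => e.symm.toLinearMap ∘ₗ f
          left_inv := fun f => by ext x : 1; simp
          right_inv := fun f => by ext x : 1; simp }
    rw [hp, hp] at h1
    exact Nat.pow_left_injective hι h1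
  have hc : Nat.card V = Nat.card W := by
    have h1 := Nat.card_congr e.toEquiv
    rw [Nat.card_fun, Nat.card_fun] at h1
    exact Nat.pow_left_injective hι h1
  have h2 := aux_inj_card key _ V rfl
  have : Finite (V →ₗ[S] V) := DFunLike.finite _
  have h3 : 0 < Nat.card {f : V →ₗ[S] V // Function.Injective f} := by
    have : Nonempty {f : V →ₗ[S] V // Function.Injective f} :=
      ⟨⟨LinearMap.id, Function.injective_id⟩⟩
    exact Nat.card_pos
  rw [h2] at h3
  obtain ⟨⟨f, hf⟩⟩ := (Nat.card_pos_iff.1 h3).1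
  exact ⟨LinearEquiv.ofBijective f ((Nat.bijective_iff_injective_and_card _).2 ⟨hf, hc⟩)⟩

theorem aux_matrix_cancel {S : Type} [CommRing S] [Finite S] {n : ℕ} {ι : Type} [Finite ι]
    [Nonempty ι] (A B : Matrix (Fin n) (Fin n) S)
    (T : (ι → Fin n → S) ≃ₗ[S] (ι → Fin n → S))
    (hT : ∀ v, T (fun i => A.mulVec (v i)) = fun i => B.mulVec (T v i)) :
    ∃ C : Matrix (Fin n) (Fin n) S, IsUnit C.det ∧ B * C = C * A := by
  let V := Module.AEval' (Matrix.toLin' A)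
  let W := Module.AEval' (Matrix.toLin' B)
  have fV : Finite V := inferInstanceAs (Finite (Fin n → S))
  have fW : Finite W := inferInstanceAs (Finite (Fin n → S))
  let T' : (ι → V) ≃+ (ι → W) := T.toAddEquiv
  have hsm : ∀ (p : S[X]) (v : ι → V), T' (p • v) = p • T' v := by
    intro p
    induction p using Polynomial.induction_on' with
    | add p q hp hq => intro v; rw [add_smul, map_add, hp, hq, add_smul]
    | monomial k a =>
      induction k with
      | zero =>
        intro v
        have h1 : (monomial 0 a : S[X]) • v = a • v := by
          funext i; exact Module.AEval.C_smul (Matrix.toLin' A) a (v i)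
        have h2 : ∀ w : ι → W, (monomial 0 a : S[X]) • w = a • w := by
          intro w; funext i; exact Module.AEval.C_smul (Matrix.toLin' B) a (w i)
        rw [h1, h2]
        exact T.map_smul a v
      | succ k ih =>
        intro v
        have h0 : (monomial (k+1) a : S[X]) = monomial k a * X := by
          rw [monomial_mul_X]
        rw [h0, mul_smul, ih, mul_smul]
        congr 1
        have h1 : (X : S[X]) • v = (fun i => A.mulVec (v i)) := by
          funext i
          exact (Module.AEval'.X_smul_of (Matrix.toLin' A) (v i)).trans (by rfl)
        have h2 : ∀ w : ι → W, (X : S[X]) • w = (fun i => B.mulVec (w i)) := by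
          intro w
          funext i
          exact (Module.AEval'.X_smul_of (Matrix.toLin' B) (w i)).trans (by rfl)
        rw [h1, h2]
        exact hT v
  let T'' : (ι → V) ≃ₗ[S[X]] (ι → W) := { T' with map_smul' := hsm }
  obtain ⟨U⟩ := aux_cancel T''
  let U' : (Fin n → S) ≃ₗ[S] (Fin n → S) :=
    (Module.AEval'.of (Matrix.toLin' A)).trans
      ((U.restrictScalars S).trans (Module.AEval'.of (Matrix.toLin' B)).symm)
  refine ⟨LinearMap.toMatrix' U'.toLinearMap, ?_, ?_⟩
  · rw [LinearMap.det_toMatrix']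
    exact LinearEquiv.isUnit_det' U'
  · apply Matrix.toLin'.injective
    rw [Matrix.toLin'_mul, Matrix.toLin'_mul, Matrix.toLin'_toMatrix']
    apply LinearMap.ext
    intro v
    have h := U.map_smul (X : S[X]) (Module.AEval'.of (Matrix.toLin' A) v)
    rw [Module.AEval'.X_smul_of] at h
    have h' := congrArg (Module.AEval'.of (Matrix.toLin' B)).symm h
    rw [Module.AEval'.of_symm_X_smul] at h'
    exact h'.symm

theorem aux_mod_gen {S R Q ι : Type} [CommRing S] [Finite S] [CommRing R] [CommRing Q] [Algebra S Q]
    [Fintype ι] [Nonempty ι] (b : Module.Basis ι S Q) (φ : R →+* Q)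
    {n : ℕ} (A B : Matrix (Fin n) (Fin n) ℤ) (C D : Matrix (Fin n) (Fin n) R)
    (hCD : C * D = 1) (hDC : D * C = 1)
    (h : A.map (Int.cast : ℤ → R) * C = C * B.map (Int.cast : ℤ → R)) :
    ∃ C : Matrix (Fin n) (Fin n) S, IsUnit C.det ∧
      A.map (Int.cast : ℤ → S) * C = C * B.map (Int.cast : ℤ → S) := by
  classical
  let F : (ι → Fin n → S) ≃ₗ[S] (Fin n → Q) :=
    { toFun := fun v j => b.equivFun.symm (fun i => v i j)
      invFun := fun w i j => b.equivFun (w j) i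
      left_inv := fun v => by
        funext i j
        exact congrFun (b.equivFun.apply_symm_apply (fun i => v i j)) i
      right_inv := fun w => by
        funext j
        exact b.equivFun.symm_apply_apply (w j)
      map_add' := fun v w => by
        funext j
        exact map_add b.equivFun.symm (fun i => v i j) (fun i => w i j)
      map_smul' := fun c v => by
        funext j
        exact map_smul b.equivFun.symm c (fun i => v i j) }
  have hF : ∀ (M : Matrix (Fin n) (Fin n) ℤ) (v : ι → Fin n → S),
      F (fun i => (M.map (Int.cast : ℤ → S)).mulVec (v i)) =
        (M.map (Int.cast : ℤ → Q)).mulVec (F v) := by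
    intro M v
    funext j
    change b.equivFun.symm (fun i => (M.map (Int.cast : ℤ → S)).mulVec (v i) j) =
      ∑ l, (M j l : Q) * b.equivFun.symm (fun i => v i l)
    have : (fun i => (M.map (Int.cast : ℤ → S)).mulVec (v i) j) =
        ∑ l, (M j l) • (fun i => v i l) := by
      funext i
      simp [Matrix.mulVec, dotProduct]
    rw [this, map_sum]
    refine Finset.sum_congr rfl fun l _ => ?_
    rw [map_zsmul, zsmul_eq_mul]
  let C1 := C.map φ
  let D1 := D.map φ
  have h1 : C1 * D1 = 1 := by
    rw [← Matrix.map_mul, hCD]; simp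
  have h2 : D1 * C1 = 1 := by
    rw [← Matrix.map_mul, hDC]; simp
  have hm : ∀ M : Matrix (Fin n) (Fin n) ℤ, (M.map (Int.cast : ℤ → R)).map φ =
      M.map (Int.cast : ℤ → Q) := by
    intro M; ext i j; simp
  have h3 : A.map (Int.cast : ℤ → Q) * C1 = C1 * B.map (Int.cast : ℤ → Q) := by
    rw [← hm, ← hm, ← Matrix.map_mul, ← Matrix.map_mul, h]
  let G : (Fin n → Q) ≃ₗ[S] (Fin n → Q) :=
    LinearEquiv.ofLinearMap ((Matrix.mulVecLin C1).restrictScalars S)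
      ((Matrix.mulVecLin D1).restrictScalars S)
      (by apply LinearMap.ext; intro x; simp [h1])
      (by apply LinearMap.ext; intro x; simp [h2])
  have hG : ∀ w, G w = C1.mulVec w := fun w => rfl
  refine aux_matrix_cancel (B.map (Int.cast : ℤ → S)) (A.map (Int.cast : ℤ → S))
    (F.trans (G.trans F.symm)) ?_
  intro v
  apply F.injective
  rw [hF]
  simp only [LinearEquiv.trans_apply, LinearEquiv.apply_symm_apply]
  rw [hF, hG, hG, Matrix.mulVec_mulVec, Matrix.mulVec_mulVec, h3]

theorem aux_mod {R : Type} [CommRing R] [Nontrivial R] [Module.Finite ℤ R] [Module.Free ℤ R]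
    {n : ℕ} (A B : Matrix (Fin n) (Fin n) ℤ) (C D : Matrix (Fin n) (Fin n) R)
    (hCD : C * D = 1) (hDC : D * C = 1)
    (h : A.map (Int.cast : ℤ → R) * C = C * B.map (Int.cast : ℤ → R))
    (q : ℕ) [NeZero q] :
    ∃ C : Matrix (Fin n) (Fin n) (ZMod q), IsUnit C.det ∧
      A.map (Int.cast : ℤ → ZMod q) * C = C * B.map (Int.cast : ℤ → ZMod q) := by
  have hne : Nonempty (Module.Free.ChooseBasisIndex ℤ R) :=
    (Module.Free.chooseBasis ℤ R).index_nonempty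
  exact aux_mod_gen (Algebra.TensorProduct.basis (ZMod q) (Module.Free.chooseBasis ℤ R))
    (Algebra.TensorProduct.includeRight : R →ₐ[ℤ] TensorProduct ℤ (ZMod q) R).toRingHom
    A B C D hCD hDC h

theorem aux_compact (p : ℕ) [Fact p.Prime] {n : ℕ} (A B : Matrix (Fin n) (Fin n) ℤ)
    (h : ∀ e : ℕ, ∃ C : Matrix (Fin n) (Fin n) (ZMod (p ^ e)), IsUnit C.det ∧
      A.map (Int.cast : ℤ → ZMod (p ^ e)) * C = C * B.map (Int.cast : ℤ → ZMod (p ^ e))) :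
    ∃ C : Matrix (Fin n) (Fin n) ℤ_[p], IsUnit C.det ∧
      A.map (Int.cast : ℤ → ℤ_[p]) * C = C * B.map (Int.cast : ℤ → ℤ_[p]) := by
  set A' := A.map (Int.cast : ℤ → ℤ_[p])
  set B' := B.map (Int.cast : ℤ → ℤ_[p])
  have h' : ∀ e : ℕ, ∃ C : Matrix (Fin n) (Fin n) ℤ_[p], ‖C.det‖ = 1 ∧
      ∀ i j, ‖(A' * C - C * B') i j‖ ≤ (p : ℝ) ^ (-((e + 1 : ℕ) : ℤ)) := by
    intro e
    obtain ⟨C, hC, hAC⟩ := h (e + 1)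
    let π := PadicInt.toZModPow (p := p) (e + 1)
    have hs : Function.Surjective π := ZMod.ringHom_surjective _
    choose g hg using hs
    let C' : Matrix (Fin n) (Fin n) ℤ_[p] := C.map g
    have hC' : C'.map π = C := by ext i j; simp [C', hg]
    refine ⟨C', ?_, ?_⟩
    · rw [← PadicInt.isUnit_iff]
      by_contra hu
      have h1 : π C'.det = C.det := by
        rw [RingHom.map_det, RingHom.mapMatrix_apply, hC']
      have h2 : (p : ℤ_[p]) ∣ C'.det := by
        have : C'.det ∈ IsLocalRing.maximalIdeal ℤ_[p] := hu
        rwa [PadicInt.maximalIdeal_eq_span_p, Ideal.mem_span_singleton] at this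
      have h3 := map_dvd π h2
      rw [h1, map_natCast] at h3
      have h4 := isUnit_of_dvd_unit h3 hC
      have h5 : ((p : ZMod (p ^ (e + 1)))) ^ (e + 1) = 0 := by
        rw [← Nat.cast_pow]; exact ZMod.natCast_self _
      have h6 := h4.pow (e + 1)
      rw [h5] at h6
      have : Fact (1 < p ^ (e + 1)) := ⟨Nat.one_lt_pow (by omega) (Fact.out : p.Prime).one_lt⟩
      exact not_isUnit_zero h6
    · intro i j
      rw [PadicInt.norm_le_pow_iff_mem_span_pow, ← PadicInt.ker_toZModPow, RingHom.mem_ker]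
      have hm : ∀ M : Matrix (Fin n) (Fin n) ℤ, (M.map (Int.cast : ℤ → ℤ_[p])).map π =
          M.map (Int.cast : ℤ → ZMod (p ^ (e + 1))) := by
        intro M; ext i j; simp
      have h1 : (A' * C' - C' * B').map π = 0 := by
        rw [Matrix.map_sub _ (map_sub π), Matrix.map_mul, Matrix.map_mul, hC', hm, hm, hAC, sub_self]
      exact congrFun (congrFun h1 i) j
  choose C hC1 hC2 using h'
  have : CompactSpace (Matrix (Fin n) (Fin n) ℤ_[p]) :=
    inferInstanceAs (CompactSpace (Fin n → Fin n → ℤ_[p]))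
  have : FirstCountableTopology (Matrix (Fin n) (Fin n) ℤ_[p]) :=
    inferInstanceAs (FirstCountableTopology (Fin n → Fin n → ℤ_[p]))
  obtain ⟨L, -, ψ, hψ, hL⟩ := isCompact_univ.tendsto_subseq (x := C) (fun _ => Set.mem_univ _)
  refine ⟨L, ?_, ?_⟩
  · rw [PadicInt.isUnit_iff]
    have c1 : Continuous (fun M : Matrix (Fin n) (Fin n) ℤ_[p] => ‖M.det‖) := by fun_prop
    have t1 := (c1.tendsto L).comp hL
    have t2 : (fun M : Matrix (Fin n) (Fin n) ℤ_[p] => ‖M.det‖) ∘ (C ∘ ψ) = fun _ => 1 := by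
      funext k; exact hC1 _
    rw [t2] at t1
    exact (tendsto_nhds_unique tendsto_const_nhds t1).symm
  · rw [← sub_eq_zero]
    ext i j : 2
    have c1 : Continuous (fun M : Matrix (Fin n) (Fin n) ℤ_[p] => ‖(A' * M - M * B') i j‖) := by
      have : Continuous (fun M : Matrix (Fin n) (Fin n) ℤ_[p] => (A' * M - M * B')) := by fun_prop
      exact (this.matrix_elem i j).norm
    have t1 := (c1.tendsto L).comp hL
    have t3 : Filter.Tendsto (fun e : ℕ => (p : ℝ) ^ (-((e + 1 : ℕ) : ℤ))) Filter.atTop (nhds 0) := by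
      have hp : 1 < (p : ℝ) := by exact_mod_cast (Fact.out : p.Prime).one_lt
      have := (tendsto_pow_atTop_nhds_zero_of_lt_one (r := (p : ℝ)⁻¹) (by positivity)
        (inv_lt_one_of_one_lt₀ hp))
      have := this.comp (Filter.tendsto_add_atTop_nat 1)
      refine this.congr fun e => ?_
      rw [zpow_neg, zpow_natCast]; simp
    have t4 := squeeze_zero (fun k => norm_nonneg _) (fun k => hC2 (ψ k) i j)
      (t3.comp hψ.tendsto_atTop)
    have := tendsto_nhds_unique t1 t4
    exact norm_eq_zero.1 this

theorem aux_backward (n : ℕ) (A B : Matrix (Fin n) (Fin n) ℤ) (R : Type) [CommRing R] [IsDomain R]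
    (hinj : Function.Injective (Int.cast : ℤ → R)) (hint : ∀ r : R, IsIntegral ℤ r)
    (C : Matrix (Fin n) (Fin n) R) (hC : IsUnit C.det)
    (h : A.map (Int.cast : ℤ → R) * C = C * B.map (Int.cast : ℤ → R)) (p : ℕ) [Fact p.Prime] :
    ∃ C : Matrix (Fin n) (Fin n) ℤ_[p],
        IsUnit C.det ∧ A.map (Int.cast : ℤ → ℤ_[p]) * C = C * B.map (Int.cast : ℤ → ℤ_[p]) := by
  apply aux_compact
  intro e
  have : NeZero (p ^ e) := ⟨pow_ne_zero _ (Fact.out : p.Prime).ne_zero⟩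
  have hz : CharZero R := by
    constructor
    intro a b hab
    have : ((a : ℤ) : R) = ((b : ℤ) : R) := by push_cast; exact hab
    exact_mod_cast hinj this
  let D := C⁻¹
  have hCD : C * D = 1 := Matrix.mul_nonsing_inv C hC
  have hDC : D * C = 1 := Matrix.nonsing_inv_mul C hC
  let s : Set R := Set.range (fun x : Fin n × Fin n => C x.1 x.2) ∪
    Set.range (fun x : Fin n × Fin n => D x.1 x.2)
  have hs : s.Finite := (Set.finite_range _).union (Set.finite_range _)
  let R0 := Algebra.adjoin ℤ s
  have hfg : Module.Finite ℤ R0 :=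
    Module.Finite.iff_fg.2 (fg_adjoin_of_finite hs (fun x _ => hint x))
  have hfree : Module.Free ℤ R0 := inferInstance
  let C0 : Matrix (Fin n) (Fin n) R0 := fun i j =>
    ⟨C i j, Algebra.subset_adjoin (Or.inl ⟨(i, j), rfl⟩)⟩
  let D0 : Matrix (Fin n) (Fin n) R0 := fun i j =>
    ⟨D i j, Algebra.subset_adjoin (Or.inr ⟨(i, j), rfl⟩)⟩
  have hi : Function.Injective (fun M : Matrix (Fin n) (Fin n) R0 => M.map R0.val) :=
    Matrix.map_injective Subtype.val_injective
  have hC0 : C0.map R0.val = C := rfl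
  have hD0 : D0.map R0.val = D := rfl
  have hm : ∀ M : Matrix (Fin n) (Fin n) ℤ, (M.map (Int.cast : ℤ → R0)).map R0.val =
      M.map (Int.cast : ℤ → R) := by
    intro M; ext i j; simp
  refine aux_mod A B C0 D0 (hi ?_) (hi ?_) (hi ?_) (p ^ e)
  · simp only [Matrix.map_mul]; rw [hC0, hD0, hCD]; simp
  · simp only [Matrix.map_mul]; rw [hC0, hD0, hDC]; simp
  · simp only [Matrix.map_mul]; rw [hC0, hm, hm, h]

theorem aux_functional {n : ℕ} {R : Type} [CommRing R] (A B : Matrix (Fin n) (Fin n) ℤ)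
    (x : Matrix (Fin n) (Fin n) ℤ →ₗ[ℤ] R) (i j : Fin n) :
    x (A.transpose * Matrix.single i j 1 - Matrix.single i j 1 * B.transpose) =
      (A.map (Int.cast : ℤ → R) * Matrix.of (fun i j => x (Matrix.single i j 1)) -
        Matrix.of (fun i j => x (Matrix.single i j 1)) * B.map (Int.cast : ℤ → R)) i j := by
  have h1 : A.transpose * Matrix.single i j 1 = ∑ l, A i l • Matrix.single l j (1 : ℤ) := by
    ext r s
    simp [Matrix.mul_apply, Matrix.sum_apply, Matrix.single_apply, ite_and]
  have h2 : Matrix.single i j 1 * B.transpose = ∑ l, B l j • Matrix.single i l (1 : ℤ) := by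
    ext r s
    simp [Matrix.mul_apply, Matrix.sum_apply, Matrix.single_apply, ite_and]
  rw [map_sub, h1, h2, map_sum, map_sum]
  simp only [map_smul]
  simp only [zsmul_eq_mul, Matrix.sub_apply, Matrix.mul_apply, Matrix.of_apply,
    Matrix.map_apply]
  congr 1
  exact Finset.sum_congr rfl fun l _ => mul_comm _ _

theorem aux_local (p : ℕ) [Fact p.Prime] {n : ℕ} (A B : Matrix (Fin n) (Fin n) ℤ)
    (C : Matrix (Fin n) (Fin n) ℤ_[p]) (hC : IsUnit C.det)
    (h : A.map (Int.cast : ℤ → ℤ_[p]) * C = C * B.map (Int.cast : ℤ → ℤ_[p])) :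
    ∃ X : Matrix (Fin n) (Fin n) ℤ, A * X = X * B ∧ ¬ (p : ℤ) ∣ X.det := by
  let x : Matrix (Fin n) (Fin n) ℤ →ₗ[ℤ] ℤ_[p] :=
    ∑ i, ∑ j, (Matrix.entryLinearMap ℤ ℤ i j).smulRight (C i j)
  have hx : ∀ i j, x (Matrix.single i j 1) = C i j := by
    intro i j
    simp [x, Matrix.single_apply, ite_and, LinearMap.sum_apply]
  have hxC : Matrix.of (fun i j => x (Matrix.single i j 1)) = C := by
    ext i j : 2; exact hx i j
  let f : Matrix (Fin n) (Fin n) ℤ →ₗ[ℤ] Matrix (Fin n) (Fin n) ℤ :=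
    LinearMap.mulLeft ℤ A.transpose - LinearMap.mulRight ℤ B.transpose
  have hf : ∀ M, f M = A.transpose * M - M * B.transpose := fun M => rfl
  have hxf : x ∘ₗ f = 0 := by
    apply Matrix.ext_linearMap ℤ
    intro i j
    ext
    simp only [LinearMap.comp_apply, Matrix.singleLinearMap_apply]
    rw [hf, aux_functional, hxC, h]; simp
  obtain ⟨k, a, y, hya, haf⟩ := Module.Flat.exists_factorization_of_comp_eq_zero_of_free hxf
  choose c hc using fun l => ZMod.intCast_surjective (PadicInt.toZMod (y (Finsupp.single l 1)))
  let y' : (Fin k →₀ ℤ) →ₗ[ℤ] ℤ := Finsupp.linearCombination ℤ c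
  have hy : ∀ v, PadicInt.toZMod (y v) = ((y' v : ℤ) : ZMod p) := by
    have : (PadicInt.toZMod (p := p)).toAddMonoidHom.toIntLinearMap ∘ₗ y =
        (Int.castRingHom (ZMod p)).toAddMonoidHom.toIntLinearMap ∘ₗ y' := by
      ext l
      simp [y', hc]
    intro v
    exact LinearMap.congr_fun this v
  let x' := y' ∘ₗ a
  let X : Matrix (Fin n) (Fin n) ℤ := Matrix.of (fun i j => x' (Matrix.single i j 1))
  refine ⟨X, ?_, ?_⟩
  · rw [← sub_eq_zero]
    ext i j
    have h1 := aux_functional A B x' i j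
    have h2 : x' (A.transpose * Matrix.single i j 1 - Matrix.single i j 1 * B.transpose) = 0 := by
      rw [← hf]
      have := LinearMap.congr_fun haf (Matrix.single i j 1)
      simp only [LinearMap.comp_apply, LinearMap.zero_apply] at this
      simp [x', this]
    rw [h2] at h1
    have hm : ∀ M : Matrix (Fin n) (Fin n) ℤ, M.map (Int.cast : ℤ → ℤ) = M := by
      intro M; ext i j; simp
    rw [hm, hm] at h1
    exact h1.symm
  · intro hd
    have h1 : X.map (Int.castRingHom (ZMod p)) = C.map (PadicInt.toZMod (p := p)) := by
      ext i j
      rw [Matrix.map_apply, Matrix.map_apply, ← hx, hya, LinearMap.comp_apply, hy]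
      rfl
    have h2 : Int.castRingHom (ZMod p) X.det = PadicInt.toZMod C.det := by
      rw [RingHom.map_det, RingHom.map_det, RingHom.mapMatrix_apply, RingHom.mapMatrix_apply, h1]
    have h3 : Int.castRingHom (ZMod p) X.det = 0 := (ZMod.intCast_zmod_eq_zero_iff_dvd _ _).2 hd
    have h4 := hC.map (PadicInt.toZMod (p := p))
    rw [← h2, h3] at h4
    exact not_isUnit_zero h4

theorem aux_det_congr {n : ℕ} (X Y : Matrix (Fin n) (Fin n) ℤ) (d : ℤ)
    (h : ∀ i j, d ∣ X i j - Y i j) : d ∣ X.det - Y.det := by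
  rw [← Ideal.mem_span_singleton, ← Ideal.Quotient.eq, RingHom.map_det, RingHom.map_det]
  congr 1
  ext i j
  simp only [RingHom.mapMatrix_apply, Matrix.map_apply]
  rw [Ideal.Quotient.eq, Ideal.mem_span_singleton]
  exact h i j

theorem aux_crt {n : ℕ} (A B : Matrix (Fin n) (Fin n) ℤ)
    (h : ∀ p : ℕ, p.Prime → ∃ X : Matrix (Fin n) (Fin n) ℤ, A * X = X * B ∧ ¬ (p : ℤ) ∣ X.det)
    (d : ℕ) (hd : d ≠ 0) :
    ∃ X : Matrix (Fin n) (Fin n) ℤ, A * X = X * B ∧ IsCoprime (d : ℤ) X.det := by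
  induction d using induction_on_primes with
  | zero => exact absurd rfl hd
  | one => exact ⟨0, by simp, by simpa using isCoprime_one_left⟩
  | prime_mul p d hp ih =>
    have hd0 : d ≠ 0 := by rintro rfl; simp at hd
    obtain ⟨X, hX, hXd⟩ := ih hd0
    have hpp : Prime (p : ℤ) := Nat.prime_iff_prime_int.1 hp
    by_cases hpd : (p : ℤ) ∣ (d : ℤ)
    · refine ⟨X, hX, ?_⟩
      push_cast
      exact IsCoprime.mul_left (hXd.of_isCoprime_of_dvd_left hpd) hXd
    · obtain ⟨Y, hY, hYp⟩ := h p hp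
      have hc : IsCoprime (p : ℤ) (d : ℤ) := (hpp.coprime_iff_not_dvd).2 hpd
      obtain ⟨u, v, huv⟩ := hc
      let Z := (u * p) • X + (v * d) • Y
      have hZ : A * Z = Z * B := by
        simp only [Z, Matrix.mul_add, Matrix.add_mul, Matrix.mul_smul, Matrix.smul_mul, hX, hY]
      refine ⟨Z, hZ, ?_⟩
      push_cast
      have e1 : (d : ℤ) ∣ Z.det - X.det := by
        apply aux_det_congr
        intro i j
        refine ⟨v * (Y i j - X i j), ?_⟩
        simp only [Z, Matrix.add_apply, Matrix.smul_apply, smul_eq_mul]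
        linear_combination (X i j) * huv
      have e2 : (p : ℤ) ∣ Z.det - Y.det := by
        apply aux_det_congr
        intro i j
        refine ⟨u * (X i j - Y i j), ?_⟩
        simp only [Z, Matrix.add_apply, Matrix.smul_apply, smul_eq_mul]
        linear_combination (Y i j) * huv
      obtain ⟨c1, h1⟩ := e1
      obtain ⟨c2, h2⟩ := e2
      have k1 : Z.det = X.det + d * c1 := by linarith
      have k2 : Z.det = Y.det + p * c2 := by linarith
      refine IsCoprime.mul_left ?_ ?_
      · rw [k2]
        exact IsCoprime.add_mul_left_right ((hpp.coprime_iff_not_dvd).2 hYp) _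
      · rw [k1]
        exact IsCoprime.add_mul_left_right hXd _

set_option linter.unusedSectionVars false

section AuxSection
variable {AuxO Ω : Type} [CommRing AuxO] [IsDomain AuxO] [CharZero AuxO] [Field Ω] [CharZero Ω]
  [IsAlgClosed Ω] [Algebra AuxO Ω]

theorem aux_root (hinj : Function.Injective (algebraMap AuxO Ω))
    (hO : ∀ o : AuxO, IsIntegral ℤ o) (hΩ : ∀ z : Ω, IsIntegral ℤ z → ∃ o, algebraMap AuxO Ω o = z)
    (g : AuxO[X]) (hg : g.Monic) (hd : g.natDegree ≠ 0) : ∃ α : AuxO, g.eval α = 0 := by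
  obtain ⟨a, ha⟩ := IsAlgClosed.exists_root (g.map (algebraMap AuxO Ω)) (by
    rw [hg.degree_map]
    rw [← Nat.pos_iff_ne_zero, natDegree_pos_iff_degree_pos] at hd; exact hd.ne')
  rw [IsRoot.def, eval_map_algebraMap] at ha
  have h1 : IsIntegral AuxO a := ⟨g, hg, ha⟩
  have : Algebra.IsIntegral ℤ AuxO := ⟨hO⟩
  have h2 : IsIntegral ℤ a := isIntegral_trans a h1
  obtain ⟨o, rfl⟩ := hΩ a h2
  refine ⟨o, hinj ?_⟩
  rw [aeval_algebraMap_apply] at ha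
  simpa using ha

theorem aux_dvd_int (hO : ∀ o : AuxO, IsIntegral ℤ o)
    (x : AuxO) (hx : x ≠ 0) : ∃ m : ℤ, m ≠ 0 ∧ x ∣ (m : AuxO) := by
  obtain ⟨r, hr, h⟩ := (hO x).isAlgebraic.exists_nonzero_dvd (mem_nonZeroDivisors_of_ne_zero hx)
  exact ⟨r, hr, by simpa using h⟩

theorem aux_idem_one (hO : ∀ o : AuxO, IsIntegral ℤ o) (x : AuxO) (m : ℤ) (hm : m ≠ 0) :
    ∃ E : ℕ, 0 < E ∧ IsIdempotentElem (Ideal.Quotient.mk (Ideal.span {(m : AuxO)}) x ^ E) := by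
  let π := Ideal.Quotient.mk (Ideal.span {(m : AuxO)})
  have hi : IsIntegral ℤ x := hO x
  let P := Algebra.adjoin ℤ {x}
  have hP : Module.Finite ℤ P := Module.Finite.iff_fg.2 hi.fg_adjoin_singleton
  have : Finite (P ⧸ Ideal.span {(m : P)}) := by
    have : NeZero m := ⟨hm⟩
    have : CharZero P := inferInstance
    apply Ideal.finiteQuotientOfFreeOfNeBot
    rw [Ne, Ideal.span_singleton_eq_bot]
    exact_mod_cast hm
  let π' := Ideal.Quotient.mk (Ideal.span {(m : P)})
  let x' : P := ⟨x, Algebra.self_mem_adjoin_singleton ℤ x⟩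
  obtain ⟨a, b, hab, h⟩ := Finite.exists_ne_map_eq_of_infinite (fun k : ℕ => π' x' ^ k)
  have key : ∀ a b : ℕ, a < b → π' x' ^ a = π' x' ^ b →
      ∃ E : ℕ, 0 < E ∧ IsIdempotentElem (π' x' ^ E) := by
    intro a b hab h
    set z := π' x'
    have h1 : ∀ k, z ^ (a + k * (b - a)) = z ^ a := by
      intro k
      induction k with
      | zero => simp
      | succ k ih =>
        rw [show a + (k + 1) * (b - a) = (a + k * (b - a)) + (b - a) by ring, pow_add, ih, ← pow_add,
          show a + (b - a) = b by omega, h]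
    have h2 : ∀ k c, z ^ (a + c + k * (b - a)) = z ^ (a + c) := by
      intro k c
      rw [show a + c + k * (b - a) = (a + k * (b - a)) + c by ring, pow_add, h1, ← pow_add]
    refine ⟨(a + 1) * (b - a), Nat.mul_pos (by omega) (by omega), ?_⟩
    have h3 : a ≤ (a + 1) * (b - a) := by
      have : 1 ≤ b - a := by omega
      nlinarith
    obtain ⟨c, hc⟩ := Nat.exists_eq_add_of_le h3
    have := h2 (a + 1) c
    rw [← hc, pow_add] at this
    exact this
  have : ∃ E : ℕ, 0 < E ∧ IsIdempotentElem (π' x' ^ E) := by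
    rcases lt_or_gt_of_ne hab with h' | h'
    · exact key a b h' h
    · exact key b a h' h.symm
  obtain ⟨E, hE, hid⟩ := this
  refine ⟨E, hE, ?_⟩
  let ψ : (P ⧸ Ideal.span {(m : P)}) →+* (AuxO ⧸ Ideal.span {(m : AuxO)}) :=
    Ideal.quotientMap _ P.val.toRingHom (by
      rw [Ideal.span_le]
      rintro _ rfl
      simp)
  have := hid.map ψ
  rwa [map_pow] at this

theorem aux_idem (hO : ∀ o : AuxO, IsIntegral ℤ o) (s : Finset AuxO) (m : ℤ) (hm : m ≠ 0) (k : ℕ) :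
    ∃ E : ℕ, k < E ∧ ∀ x ∈ s,
      IsIdempotentElem (Ideal.Quotient.mk (Ideal.span {(m : AuxO)}) x ^ E) := by
  choose f hf0 hf using fun x => aux_idem_one hO x m hm
  refine ⟨(∏ x ∈ s, f x) * (k + 1), ?_, ?_⟩
  · have : 0 < ∏ x ∈ s, f x := Finset.prod_pos fun x _ => hf0 x
    nlinarith
  · intro x hx
    obtain ⟨c, hc⟩ := Finset.dvd_prod_of_mem f hx
    rw [hc, mul_assoc, pow_mul]
    exact (hf x).pow _

theorem aux_idem_unit {Q : Type} [CommRing Q] (u v a b : Q) (hu : IsIdempotentElem u)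
    (hv : IsIdempotentElem v) (h : a * u + b * v = 1) : u * u - u * v + v * v = 1 := by
  have hu' : u * u = u := hu
  have hv' : v * v = v := hv
  have e : (1 - u) * (1 - v) = 0 := by
    calc (1 - u) * (1 - v) = (1 - u) * (1 - v) * (a * u + b * v) := by rw [h, mul_one]
      _ = (1 - v) * a * (u - u * u) + (1 - u) * b * (v - v * v) := by ring
      _ = 0 := by rw [hu', hv']; ring
  rw [hu', hv']
  linear_combination -e

theorem aux_principal {OK : Type} [CommRing OK] [IsDedekindDomain OK] [Fintype (ClassGroup OK)]
    (x y : OK) (hy0 : y ≠ 0) :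
    ∃ h : ℕ, h ≠ 0 ∧ ∃ δ : OK, (Ideal.span {x, y}) ^ h = Ideal.span {δ} := by
  have hI0 : Ideal.span {x, y} ≠ ⊥ := by
    intro h
    have : y ∈ Ideal.span {x, y} := Ideal.subset_span (by simp)
    rw [h] at this
    exact hy0 this
  have hI : Ideal.span {x, y} ∈ nonZeroDivisors (Ideal OK) := mem_nonZeroDivisors_of_ne_zero hI0
  obtain ⟨k, hk, h1⟩ : ∃ k : ℕ, k ≠ 0 ∧ (ClassGroup.mk0 ⟨Ideal.span {x, y}, hI⟩) ^ k = 1 :=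
    ⟨Fintype.card (ClassGroup OK), Fintype.card_ne_zero, pow_card_eq_one⟩
  refine ⟨k, hk, ?_⟩
  have h3 : ClassGroup.mk0 ⟨Ideal.span {x, y} ^ k, pow_mem hI k⟩ = 1 := by
    rw [← h1, ← map_pow, SubmonoidClass.mk_pow]
  have h2 := (ClassGroup.mk0_eq_one_iff _).1 h3
  exact ⟨_, (Ideal.span_singleton_generator _).symm⟩

theorem aux_bezout_gen (hinj : Function.Injective (algebraMap AuxO Ω))
    (hO : ∀ o : AuxO, IsIntegral ℤ o) (hΩ : ∀ z : Ω, IsIntegral ℤ z → ∃ o, algebraMap AuxO Ω o = z)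
    (ρ : Ω) {OK : Type} [CommRing OK] [IsDedekindDomain OK] [Fintype (ClassGroup OK)]
    (hint : ∀ z : OK, IsIntegral ℤ z)
    (i0 : OK →+* Ω) (hi0 : Function.Injective i0) (x y : OK) (hy0 : y ≠ 0) (e2 : i0 x = i0 y * ρ) :
    ∃ γ β : AuxO, β ≠ 0 ∧
    algebraMap AuxO Ω γ = algebraMap AuxO Ω β * ρ ∧ IsCoprime γ β := by
  have hrange : ∀ z : OK, ∃ o, algebraMap AuxO Ω o = i0 z := by
    intro z
    apply hΩ
    exact (hint z).map i0.toIntAlgHom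
  choose j' hj' using hrange
  let j : OK →+* AuxO :=
    { toFun := j'
      map_one' := hinj (by rw [hj', map_one, map_one])
      map_zero' := hinj (by rw [hj', map_zero, map_zero])
      map_add' := fun a b => hinj (by rw [hj', map_add, map_add, hj', hj'])
      map_mul' := fun a b => hinj (by rw [hj', map_mul, map_mul, hj', hj']) }
  have hji : ∀ z, algebraMap AuxO Ω (j z) = i0 z := hj'
  have hj : Function.Injective j := by
    intro a b hab
    apply hi0
    rw [← hji, hab, hji]
  clear_value j
  clear hj'
  obtain ⟨h, hh, δ, hδ'⟩ := aux_principal x y hy0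
  set I : Ideal OK := Ideal.span {x, y} with hIdef
  have hyI : y ∈ I := Ideal.subset_span (by simp)
  have hδ0 : δ ≠ 0 := by
    rintro rfl
    have h1 : y ^ h ∈ I ^ h := Ideal.pow_mem_pow hyI h
    rw [hδ', Ideal.mem_span_singleton, zero_dvd_iff] at h1
    exact hy0 (pow_eq_zero_iff hh |>.1 h1)
  obtain ⟨ε, hε⟩ := aux_root hinj hO hΩ (X ^ h - C (j δ)) (monic_X_pow_sub_C _ hh)
    (by rw [natDegree_X_pow_sub_C]; exact hh)
  simp only [eval_sub, eval_pow, eval_X, eval_C, sub_eq_zero] at hε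
  have hε0 : ε ≠ 0 := by
    rintro rfl
    rw [zero_pow hh] at hε
    exact hδ0 (hj (by rw [← hε, map_zero]))
  have hε0' : algebraMap AuxO Ω ε ≠ 0 := fun h => hε0 (hinj (by rw [h, map_zero]))
  have hdiv : ∀ z ∈ I, ε ∣ j z := by
    intro z hz
    have : z ^ h ∈ I ^ h := Ideal.pow_mem_pow hz h
    rw [hδ', Ideal.mem_span_singleton] at this
    have h3 := map_dvd j this
    rw [map_pow, ← hε] at h3
    obtain ⟨c, hc⟩ := h3
    have h4 : IsIntegral ℤ (algebraMap AuxO Ω (j z) / algebraMap AuxO Ω ε) := by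
      apply IsIntegral.of_pow (Nat.pos_of_ne_zero hh)
      rw [div_pow, ← map_pow, hc, map_mul, map_pow, mul_div_cancel_left₀ _ (pow_ne_zero _ hε0')]
      exact (hO c).map (algebraMap AuxO Ω).toIntAlgHom
    obtain ⟨o, ho⟩ := hΩ _ h4
    refine ⟨o, hinj ?_⟩
    rw [map_mul, ho]
    field_simp
  obtain ⟨γ, hγ⟩ := hdiv x (Ideal.subset_span (by simp))
  obtain ⟨β, hβ⟩ := hdiv y hyI
  have hβ0 : β ≠ 0 := by
    rintro rfl
    rw [mul_zero] at hβ
    exact hy0 (hj (by rw [hβ, map_zero]))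
  refine ⟨γ, β, hβ0, ?_, ?_⟩
  · rw [← hji, ← hji, hγ, hβ, map_mul, map_mul] at e2
    apply mul_left_cancel₀ hε0'
    rw [e2, mul_assoc]
  · have h4 : Ideal.map j I = Ideal.span {ε} * Ideal.span {γ, β} := by
      rw [hIdef, Ideal.map_span, Set.image_pair, hγ, hβ, Ideal.span_mul_span]
      simp [Set.image_pair]
    have h5 : j δ ∈ (Ideal.map j I) ^ h := by
      rw [← Ideal.map_pow]
      apply Ideal.mem_map_of_mem
      rw [hδ']
      exact Ideal.mem_span_singleton_self δ
    rw [h4, mul_pow, Ideal.span_singleton_pow, Ideal.mem_span_singleton_mul] at h5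
    obtain ⟨z, hz, hz2⟩ := h5
    rw [hε] at hz2
    have hz1 : z = 1 := by
      have : j δ ≠ 0 := fun h => hδ0 (hj (by rw [h, map_zero]))
      exact mul_left_cancel₀ this (by rw [hz2, mul_one])
    rw [hz1] at hz
    have h6 : (1 : AuxO) ∈ Ideal.span {γ, β} := Ideal.pow_le_self hh hz
    rw [Ideal.mem_span_pair] at h6
    obtain ⟨a, b, hab⟩ := h6
    exact ⟨a, b, hab⟩

theorem aux_bezout (hinj : Function.Injective (algebraMap AuxO Ω))
    (hO : ∀ o : AuxO, IsIntegral ℤ o) (hΩ : ∀ z : Ω, IsIntegral ℤ z → ∃ o, algebraMap AuxO Ω o = z)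
    (ρ : Ω) (hρ : IsIntegral ℚ ρ) : ∃ γ β : AuxO, β ≠ 0 ∧
    algebraMap AuxO Ω γ = algebraMap AuxO Ω β * ρ ∧ IsCoprime γ β := by
  let K := IntermediateField.adjoin ℚ {ρ}
  have hfd : FiniteDimensional ℚ K := IntermediateField.adjoin.finiteDimensional hρ
  have hnf : NumberField K := ⟨⟩
  let OK := NumberField.RingOfIntegers K
  let r : K := ⟨ρ, IntermediateField.mem_adjoin_simple_self ℚ ρ⟩
  obtain ⟨x, y, hy, hxy⟩ := IsFractionRing.div_surjective (A := OK) r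
  have hy0 : y ≠ 0 := nonZeroDivisors.ne_zero hy
  let i0 : OK →+* Ω := (algebraMap K Ω).comp (algebraMap OK K)
  have hi0 : Function.Injective i0 :=
    (algebraMap K Ω).injective.comp (FaithfulSMul.algebraMap_injective OK K)
  have e2 : i0 x = i0 y * ρ := by
    have e1 : algebraMap OK K x = algebraMap OK K y * r := by
      rw [← hxy]
      have : algebraMap OK K y ≠ 0 := fun h => hy0 (FaithfulSMul.algebraMap_injective OK K (by rw [h, map_zero]))
      field_simp
    exact congrArg (algebraMap K Ω) e1 |>.trans (map_mul _ _ _)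
  exact aux_bezout_gen hinj hO hΩ ρ NumberField.RingOfIntegers.isIntegral i0 hi0 x y hy0 e2

theorem aux_multi (hinj : Function.Injective (algebraMap AuxO Ω))
    (hO : ∀ o : AuxO, IsIntegral ℤ o) (hΩ : ∀ z : Ω, IsIntegral ℤ z → ∃ o, algebraMap AuxO Ω o = z)
    (Z : Finset Ω) (γ β σ τ : Ω → AuxO) (hβ : ∀ ρ ∈ Z, β ρ ≠ 0)
    (hγ : ∀ ρ ∈ Z, algebraMap AuxO Ω (γ ρ) = algebraMap AuxO Ω (β ρ) * ρ)
    (hc : ∀ ρ ∈ Z, σ ρ * γ ρ + τ ρ * β ρ = 1) :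
    ∃ α : AuxO, ∀ ρ ∈ Z, IsUnit (γ ρ - β ρ * α) := by
  classical
  have hβ' : ∀ ρ ∈ Z, algebraMap AuxO Ω (β ρ) ≠ 0 := fun ρ hρ h =>
    hβ ρ hρ (hinj (by rw [h, map_zero]))
  let δ : Ω → AuxO := fun ρ => ∏ ρ' ∈ Z.erase ρ, (β ρ' * γ ρ - γ ρ' * β ρ)
  have hδ : ∀ ρ ∈ Z, δ ρ ≠ 0 := by
    intro ρ hρ
    rw [Finset.prod_ne_zero_iff]
    intro ρ' hρ' h0
    have hne := Finset.ne_of_mem_erase hρ'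
    have hm := Finset.mem_of_mem_erase hρ'
    have h1 := congrArg (algebraMap AuxO Ω) h0
    rw [map_sub, map_mul, map_mul, hγ ρ hρ, hγ ρ' hm, map_zero] at h1
    have h2 : algebraMap AuxO Ω (β ρ') * algebraMap AuxO Ω (β ρ) * (ρ - ρ') = 0 := by
      linear_combination h1
    rcases mul_eq_zero.1 h2 with h3 | h3
    · exact (mul_ne_zero (hβ' ρ' hm) (hβ' ρ hρ)) h3
    · exact hne (sub_eq_zero.1 h3).symm
  obtain ⟨m, hm, hdm⟩ := aux_dvd_int hO (∏ ρ ∈ Z, β ρ * δ ρ)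
    (Finset.prod_ne_zero_iff.2 fun ρ hρ => mul_ne_zero (hβ ρ hρ) (hδ ρ hρ))
  obtain ⟨E, hE, hid⟩ := aux_idem hO (Z.image γ ∪ Z.image β) m hm Z.card
  have hlam : ∀ ρ ∈ Z, ∃ l : AuxO, β ρ * δ ρ * l =
      1 - (γ ρ ^ E * γ ρ ^ E - γ ρ ^ E * β ρ ^ E + β ρ ^ E * β ρ ^ E) := by
    intro ρ hρ
    have h1 := hid (γ ρ) (Finset.mem_union_left _ (Finset.mem_image_of_mem _ hρ))
    have h2 := hid (β ρ) (Finset.mem_union_right _ (Finset.mem_image_of_mem _ hρ))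
    have hcop : IsCoprime (γ ρ) (β ρ) := ⟨σ ρ, τ ρ, hc ρ hρ⟩
    obtain ⟨a, b, hab⟩ := hcop.pow (m := E) (n := E)
    have h3 := congrArg (Ideal.Quotient.mk (Ideal.span {(m : AuxO)})) hab
    simp only [map_add, map_mul, map_pow, map_one] at h3
    have h4 := aux_idem_unit _ _ _ _ h1 h2 h3
    have h5 : (m : AuxO) ∣ 1 - (γ ρ ^ E * γ ρ ^ E - γ ρ ^ E * β ρ ^ E + β ρ ^ E * β ρ ^ E) := by
      rw [← Ideal.mem_span_singleton, ← Ideal.Quotient.eq]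
      simp only [map_add, map_sub, map_mul, map_pow, map_one]
      exact h4.symm
    obtain ⟨l, hl⟩ := ((Finset.dvd_prod_of_mem (fun ρ => β ρ * δ ρ) hρ).trans hdm).trans h5
    exact ⟨l, hl.symm⟩
  choose! l hl using hlam
  let H : Ω → AuxO[X] := fun ρ => (∏ ρ' ∈ Z.erase ρ, (C (β ρ') * X - C (γ ρ'))) *
    (C (σ ρ) * X + C (τ ρ)) ^ (2 * E - Z.card)
  let r : AuxO[X] := -X ^ E + 1 + ∑ ρ ∈ Z, C (l ρ) * H ρ
  have hr : r ∈ degreeLT AuxO (2 * E) := by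
    refine add_mem (add_mem (neg_mem ?_) ?_) (sum_mem fun ρ hρ => ?_)
    · rw [mem_degreeLT]
      refine (degree_X_pow_le E).trans_lt ?_
      exact_mod_cast (by omega : E < 2 * E)
    · rw [mem_degreeLT]
      refine degree_one_le.trans_lt ?_
      exact_mod_cast (by omega : 0 < 2 * E)
    · rw [mem_degreeLT]
      have hcard : 1 ≤ Z.card := Finset.card_pos.2 ⟨ρ, hρ⟩
      have d1 : (∏ ρ' ∈ Z.erase ρ, (C (β ρ') * X - C (γ ρ'))).natDegree ≤ Z.card - 1 := by
        refine (natDegree_prod_le _ _).trans ?_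
        rw [← Finset.card_erase_of_mem hρ, Finset.card_eq_sum_ones]
        refine Finset.sum_le_sum fun i _ => ?_
        rw [sub_eq_add_neg, ← C_neg]
        exact natDegree_linear_le
      have d2 : ((C (σ ρ) * X + C (τ ρ)) ^ (2 * E - Z.card)).natDegree ≤ 2 * E - Z.card := by
        refine natDegree_pow_le.trans ?_
        have : (C (σ ρ) * X + C (τ ρ)).natDegree ≤ 1 := natDegree_linear_le
        nlinarith
      have d3 : (C (l ρ) * H ρ).natDegree ≤ 2 * E - 1 := by
        refine (natDegree_C_mul_le _ _).trans (natDegree_mul_le.trans ?_)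
        omega
      refine degree_le_natDegree.trans_lt ?_
      exact_mod_cast (by omega : (C (l ρ) * H ρ).natDegree < 2 * E)
  rw [mem_degreeLT] at hr
  have hr' : degree r < ((2 * E : ℕ) : WithBot ℕ) := by exact_mod_cast hr
  let g := X ^ (2 * E) + r
  have hgm : g.Monic := monic_X_pow_add hr'
  have hgd : g.natDegree = 2 * E := by
    have h1 : degree r < degree (X ^ (2 * E) : Polynomial AuxO) := by
      rw [degree_X_pow]; exact hr'
    have h2 := natDegree_add_eq_left_of_degree_lt h1
    rw [natDegree_X_pow] at h2
    exact h2
  obtain ⟨α, hα⟩ := aux_root hinj hO hΩ g hgm (by omega)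
  refine ⟨α, fun ρ hρ => ?_⟩
  have hHo : ∀ ρ' ∈ Z, ρ' ≠ ρ → aeval ρ (H ρ') = 0 := by
    intro ρ' hρ' hne
    simp only [H, map_mul, map_prod]
    rw [Finset.prod_eq_zero (Finset.mem_erase.2 ⟨hne.symm, hρ⟩), zero_mul]
    simp [hγ ρ hρ]
  set b := algebraMap AuxO Ω (β ρ) with hb
  have hHs : b ^ (2 * E - 1) * aeval ρ (H ρ) = algebraMap AuxO Ω (δ ρ) := by
    have hcard : 1 ≤ Z.card := Finset.card_pos.2 ⟨ρ, hρ⟩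
    rw [show 2 * E - 1 = (Z.erase ρ).card + (2 * E - Z.card) by
      rw [Finset.card_erase_of_mem hρ]; omega]
    simp only [H, map_mul, map_prod, map_pow, δ]
    have k1 : b ^ (2 * E - Z.card) * (aeval ρ (C (σ ρ) * X + C (τ ρ))) ^ (2 * E - Z.card) = 1 := by
      rw [← mul_pow]
      have : b * aeval ρ (C (σ ρ) * X + C (τ ρ)) = 1 := by
        have := congrArg (algebraMap AuxO Ω) (hc ρ hρ)
        simp only [map_add, map_mul, map_one, hγ ρ hρ] at this
        simp only [map_add, map_mul, aeval_C, aeval_X]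
        rw [← this]; ring
      rw [this, one_pow]
    have k2 : b ^ (Z.erase ρ).card * ∏ ρ' ∈ Z.erase ρ, aeval ρ (C (β ρ') * X - C (γ ρ')) =
        ∏ ρ' ∈ Z.erase ρ, algebraMap AuxO Ω (β ρ' * γ ρ - γ ρ' * β ρ) := by
      rw [← Finset.prod_const, ← Finset.prod_mul_distrib]
      refine Finset.prod_congr rfl fun ρ' _ => ?_
      simp only [map_sub, map_mul, aeval_C, aeval_X, hγ ρ hρ]
      ring
    rw [← k2, pow_add]
    linear_combination (b ^ (Z.erase ρ).card *
      ∏ ρ' ∈ Z.erase ρ, aeval ρ (C (β ρ') * X - C (γ ρ'))) * k1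
  have hg1 : b ^ (2 * E) * aeval ρ g = 1 := by
    have s1 : aeval ρ g = ρ ^ (2 * E) - ρ ^ E + 1 + algebraMap AuxO Ω (l ρ) * aeval ρ (H ρ) := by
      simp only [g, r, map_add, map_neg, map_pow, aeval_X, map_one, map_sum, map_mul, aeval_C]
      rw [Finset.sum_eq_single ρ (fun ρ' h1 h2 => by rw [hHo ρ' h1 h2, mul_zero])
        (fun h => absurd hρ h)]
      ring
    have s2 := congrArg (algebraMap AuxO Ω) (hl ρ hρ)
    simp only [map_add, map_sub, map_mul, map_pow, map_one, hγ ρ hρ] at s2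
    rw [← hb] at s2
    have s3 : b ^ (2 * E) = b * b ^ (2 * E - 1) := by
      rw [← pow_succ']; congr 1; omega
    have s4 : b ^ (2 * E) = b ^ E * b ^ E := by rw [← pow_add]; congr 1; omega
    have s5 : ρ ^ (2 * E) = ρ ^ E * ρ ^ E := by rw [← pow_add]; congr 1; omega
    rw [s1]
    simp only [mul_pow] at s2
    have s6 : b ^ (2 * E) * (algebraMap AuxO Ω (l ρ) * aeval ρ (H ρ)) =
        b * algebraMap AuxO Ω (δ ρ) * algebraMap AuxO Ω (l ρ) := by
      rw [s3, ← hHs]; ring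
    rw [mul_add, s6, s2, s4, s5]
    ring
  have e1 : (scaleRoots g (β ρ)).eval (γ ρ) = 1 := by
    apply hinj
    rw [map_one, ← hg1, ← eval₂_hom (algebraMap AuxO Ω), hγ ρ hρ, scaleRoots_eval₂_mul, hgd, aeval_def]
  have e2 : (scaleRoots g (β ρ)).eval (β ρ * α) = 0 := by
    rw [scaleRoots_eval_mul, hα, mul_zero]
  have e3 := sub_dvd_eval_sub (γ ρ) (β ρ * α) (scaleRoots g (β ρ))
  rw [e1, e2, sub_zero] at e3
  exact isUnit_of_dvd_one e3

theorem aux_skolem (hinj : Function.Injective (algebraMap AuxO Ω))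
    (hO : ∀ o : AuxO, IsIntegral ℤ o) (hΩ : ∀ z : Ω, IsIntegral ℤ z → ∃ o, algebraMap AuxO Ω o = z)
    (f : ℤ[X]) (hf : f ≠ 0) (hcop : IsCoprime f.leadingCoeff (f.coeff 0)) :
    ∃ α : AuxO, IsUnit (aeval α f) := by
  classical
  let F : Polynomial Ω := f.map (Int.castRingHom Ω)
  have hic : Function.Injective (Int.castRingHom Ω) := (Int.castRingHom Ω).injective_int
  have hF0 : F ≠ 0 := (Polynomial.map_ne_zero_iff hic).2 hf
  have hlead : F.leadingCoeff = (f.leadingCoeff : Ω) := leadingCoeff_map_of_injective hic f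
  have hroots : ∀ ρ ∈ F.roots.toFinset, ∃ γ β σ τ : AuxO, β ≠ 0 ∧
      algebraMap AuxO Ω γ = algebraMap AuxO Ω β * ρ ∧ σ * γ + τ * β = 1 := by
    intro ρ hρ
    rw [Multiset.mem_toFinset, mem_roots hF0, IsRoot.def] at hρ
    have halg : IsAlgebraic ℤ ρ := ⟨f, hf, by rw [aeval_def, ← eval_map]; exact hρ⟩
    have hI : IsIntegral ℚ ρ := (halg.extendScalars (S := ℚ) (algebraMap ℤ ℚ).injective_int).isIntegral
    obtain ⟨γ, β, h1, h2, σ, τ, h3⟩ := aux_bezout hinj hO hΩ ρ hI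
    exact ⟨γ, β, σ, τ, h1, h2, h3⟩
  choose! γ β σ τ hβ hγ hc using hroots
  obtain ⟨α, hα⟩ := aux_multi hinj hO hΩ F.roots.toFinset γ β σ τ hβ hγ hc
  refine ⟨α, ?_⟩
  let P := (F.roots.map β).prod
  have key : ∀ z : AuxO, P * aeval z f =
      (f.leadingCoeff : AuxO) * (F.roots.map (fun ρ => β ρ * z - γ ρ)).prod := by
    intro z
    apply hinj
    have h1 : algebraMap AuxO Ω (aeval z f) = F.eval (algebraMap AuxO Ω z) := by
      rw [eval_map, aeval_def, hom_eval₂]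
      congr 1
      exact RingHom.ext_int _ _
    rw [map_mul, map_mul, h1, (IsAlgClosed.splits F).eval_eq_prod_roots, hlead, map_intCast,
      map_multiset_prod, map_multiset_prod, Multiset.map_map, Multiset.map_map, mul_left_comm,
      ← Multiset.prod_map_mul]
    congr 2
    refine Multiset.map_congr rfl fun ρ hρ => ?_
    simp only [Function.comp_apply, map_sub, map_mul, hγ ρ (Multiset.mem_toFinset.2 hρ)]
    ring
  have hU : IsUnit (F.roots.map (fun ρ => β ρ * α - γ ρ)).prod := by
    apply Multiset.prod_induction IsUnit _ (fun a b ha hb => ha.mul hb) isUnit_one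
    intro a ha
    obtain ⟨ρ, hρ, rfl⟩ := Multiset.mem_map.1 ha
    rw [← neg_sub]
    exact (hα ρ (Multiset.mem_toFinset.2 hρ)).neg
  have k0 := key 0
  have kα := key α
  set Q0 := (F.roots.map (fun ρ => β ρ * 0 - γ ρ)).prod
  set Qα := (F.roots.map (fun ρ => β ρ * α - γ ρ)).prod
  have hf0 : aeval (0 : AuxO) f = ((f.coeff 0 : ℤ) : AuxO) := by
    rw [← coeff_zero_eq_aeval_zero']; simp
  rw [hf0] at k0
  obtain ⟨u, v, huv⟩ := hcop
  have huv' : (u : AuxO) * f.leadingCoeff + v * f.coeff 0 = 1 := by exact_mod_cast huv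
  have ha0 : (f.leadingCoeff : AuxO) ≠ 0 := by
    exact_mod_cast leadingCoeff_ne_zero.2 hf
  have hP : P = (f.leadingCoeff : AuxO) * (u * P + v * Q0) := by
    linear_combination (-P) * huv' + (v : AuxO) * k0
  have hfin : (u * P + v * Q0) * aeval α f = Qα := by
    apply mul_left_cancel₀ ha0
    rw [← kα, ← mul_assoc, ← hP]
  rw [← hfin] at hU
  exact isUnit_of_mul_isUnit_right hU

end AuxSection

theorem aux_forward (n : ℕ) (A B : Matrix (Fin n) (Fin n) ℤ)
    (h : ∀ p : ℕ, p.Prime → ∃ X : Matrix (Fin n) (Fin n) ℤ, A * X = X * B ∧ ¬ (p : ℤ) ∣ X.det)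
    {O : Type} [CommRing O] [IsDomain O] [CharZero O] [Algebra O ℂ]
    (hinj : Function.Injective (algebraMap O ℂ))
    (hO : ∀ o : O, IsIntegral ℤ o) (hΩ : ∀ z : ℂ, IsIntegral ℤ z → ∃ o, algebraMap O ℂ o = z) :
    ∃ C : Matrix (Fin n) (Fin n) O,
      IsUnit C.det ∧ A.map (Int.cast : ℤ → O) * C = C * B.map (Int.cast : ℤ → O) := by
  obtain ⟨X1, hX1, hd1⟩ := h 2 Nat.prime_two
  have hd0 : X1.det ≠ 0 := fun h0 => hd1 (by rw [h0]; exact dvd_zero _)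
  obtain ⟨X2, hX2, hcop⟩ := aux_crt A B h X1.det.natAbs (Int.natAbs_ne_zero.2 hd0)
  have hcop' : IsCoprime X1.det X2.det := by
    exact hcop.of_isCoprime_of_dvd_left (Int.dvd_natAbs.2 dvd_rfl)
  let f : ℤ[X] := ((X : ℤ[X]) • X1.map C + X2.map C).det
  have hc0 : f.coeff 0 = X2.det := coeff_det_X_add_C_zero X1 X2
  have hcn : f.coeff n = X1.det := by
    have := coeff_det_X_add_C_card X1 X2
    rwa [Fintype.card_fin] at this
  have hfd : f.natDegree ≤ n := by
    have := natDegree_det_X_add_C_le X1 X2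
    rwa [Fintype.card_fin] at this
  have hfd' : f.natDegree = n :=
    le_antisymm hfd (le_natDegree_of_ne_zero (by rw [hcn]; exact hd0))
  have hf0 : f ≠ 0 := by
    intro h0
    rw [h0, coeff_zero] at hcn
    exact hd0 hcn.symm
  have hfl : f.leadingCoeff = X1.det := by rw [leadingCoeff, hfd', hcn]
  obtain ⟨α, hα⟩ := aux_skolem hinj hO hΩ f hf0 (by rw [hfl, hc0]; exact hcop')
  refine ⟨α • X1.map (Int.cast : ℤ → O) + X2.map (Int.cast : ℤ → O), ?_, ?_⟩
  · convert hα using 1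
    have : aeval α f = (aeval α : ℤ[X] →ₐ[ℤ] O).toRingHom f := rfl
    rw [this, RingHom.map_det]
    congr 1
    ext i j
    simp
  · have e : ∀ M N : Matrix (Fin n) (Fin n) ℤ, M.map (Int.cast : ℤ → O) * N.map (Int.cast : ℤ → O) =
        (M * N).map (Int.cast : ℤ → O) := fun M N =>
      (Matrix.map_mul (f := Int.castRingHom O)).symm
    rw [Matrix.mul_add, Matrix.add_mul, Matrix.mul_smul, Matrix.smul_mul, e, e, e, e, hX1, hX2]

/-- Guralnick: Integral matrices `A, B` are `ℤ_p`-conjugate for every prime `p`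
if and only if they are conjugate over some algebraic integral extension of `ℤ`, i.e. over a
commutative integral domain `R` in which `ℤ` embeds and all of whose elements are integral
over `ℤ`. -/
theorem locally_conjugate_iff_conjugate_over_integral_extension
    (n : ℕ) (A B : Matrix (Fin n) (Fin n) ℤ) :
    (∀ (p : ℕ) [Fact p.Prime],
      ∃ C : Matrix (Fin n) (Fin n) ℤ_[p],
        IsUnit C.det ∧ A.map (Int.cast : ℤ → ℤ_[p]) * C = C * B.map (Int.cast : ℤ → ℤ_[p]))
    ↔ ∃ (R : Type) (_ : CommRing R), IsDomain R ∧
        Function.Injective (Int.cast : ℤ → R) ∧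
        (∀ r : R, IsIntegral ℤ r) ∧
        ∃ C : Matrix (Fin n) (Fin n) R,
          IsUnit C.det ∧ A.map (Int.cast : ℤ → R) * C = C * B.map (Int.cast : ℤ → R) := by
  constructor
  · intro h
    have h' : ∀ p : ℕ, p.Prime →
        ∃ X : Matrix (Fin n) (Fin n) ℤ, A * X = X * B ∧ ¬ (p : ℤ) ∣ X.det := by
      intro p hp
      have : Fact p.Prime := ⟨hp⟩
      obtain ⟨C, hC, hAC⟩ := h p
      exact aux_local p A B C hC hAC
    have hinj : Function.Injective (algebraMap (integralClosure ℤ ℂ) ℂ) := Subtype.val_injective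
    have hO : ∀ o : integralClosure ℤ ℂ, IsIntegral ℤ o := Algebra.IsIntegral.isIntegral
    refine ⟨integralClosure ℤ ℂ, inferInstance, inferInstance, Int.cast_injective, hO, ?_⟩
    exact aux_forward n A B h' hinj hO (fun z hz => ⟨⟨z, hz⟩, rfl⟩)
  · rintro ⟨R, _, _, hinj, hint, C, hC, h⟩ p _
    exact aux_backward n A B R hinj hint C hC h p
end

section
/- The polynomial g = x⁴ + 12x² + 16 is irreducible over ℚ; let K₁ = ℚ[x]/(g) and let R be the ring of integers of K₁ (the integral closure of ℤ in K₁). Then the matrices A = [[0, 1], [−5, 0]] and B = [[−1, 2], [−3, 1]] are not R-conjugate: there is no C ∈ R^{2×2} with det C a unit of R and A·C = C·B. (Here K₁ is the Hilbert class field of ℚ(√−5), so locally conjugate integral matrices need not be conjugate over the ring of integers of the Hilbert class field.) -/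
open Polynomial

/-- The ring of integers (integral closure of `ℤ`) of `K₁ = ℚ[x]/(x⁴ + 12x² + 16)`,
the Hilbert class field of `ℚ(√-5)`. -/
noncomputable def ringOfIntegersK1 : Type :=
  ↥(integralClosure ℤ (AdjoinRoot (X ^ 4 + 12 * X ^ 2 + 16 : ℚ[X])))

noncomputable instance : CommRing ringOfIntegersK1 :=
  inferInstanceAs (CommRing ↥(integralClosure ℤ (AdjoinRoot (X ^ 4 + 12 * X ^ 2 + 16 : ℚ[X]))))

namespace HCF
open QuadraticAlgebra

abbrev ZZ := QuadraticAlgebra ℤ 1 1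
abbrev OO := QuadraticAlgebra ZZ (-1) 0
abbrev FF := QuadraticAlgebra ℚ 1 1
abbrev LL := QuadraticAlgebra FF (-1) 0

lemma sum_sq_one (p q : ZZ) (h : p ^ 2 + q ^ 2 = 1) :
    (p = 1 ∧ q = 0) ∨ (p = -1 ∧ q = 0) ∨ (p = 0 ∧ q = 1) ∨ (p = 0 ∧ q = -1) := by
  obtain ⟨a, b⟩ := p
  obtain ⟨c, d⟩ := q
  simp only [QuadraticAlgebra.ext_iff, pow_two, re_add, re_mul, im_add, im_mul, re_one, im_one,
    re_neg, im_neg, re_zero, im_zero] at h ⊢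
  obtain ⟨h1, h2⟩ := h
  have ha : a ≤ 1 := by nlinarith [sq_nonneg b, sq_nonneg c, sq_nonneg d]
  have ha' : -1 ≤ a := by nlinarith [sq_nonneg b, sq_nonneg c, sq_nonneg d]
  have hb : b ≤ 1 := by nlinarith [sq_nonneg a, sq_nonneg c, sq_nonneg d]
  have hb' : -1 ≤ b := by nlinarith [sq_nonneg a, sq_nonneg c, sq_nonneg d]
  have hc : c ≤ 1 := by nlinarith [sq_nonneg b, sq_nonneg a, sq_nonneg d]
  have hc' : -1 ≤ c := by nlinarith [sq_nonneg b, sq_nonneg a, sq_nonneg d]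
  have hd : d ≤ 1 := by nlinarith [sq_nonneg b, sq_nonneg c, sq_nonneg a]
  have hd' : -1 ≤ d := by nlinarith [sq_nonneg b, sq_nonneg c, sq_nonneg a]
  interval_cases a <;> interval_cases b <;> interval_cases c <;> interval_cases d <;> simp_all

lemma two_cancel (y : ZZ) (h : y + y = 0) : y = 0 := by
  simp only [QuadraticAlgebra.ext_iff, re_add, im_add, re_zero, im_zero] at h ⊢
  omega

/-- `1 + i` is not a unit -/
lemma not_unit (x t : OO) (h : (⟨1, 1⟩ : OO) * x * t = 1) : False := by
  have h2 := congrArg QuadraticAlgebra.norm h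
  rw [map_mul, map_mul, map_one, mul_assoc] at h2
  have h3 : QuadraticAlgebra.norm (⟨1, 1⟩ : OO) = 2 := by
    simp [norm_def]; norm_num
  rw [h3] at h2
  have := congrArg QuadraticAlgebra.re h2
  simp only [re_mul, re_ofNat, im_ofNat, re_one] at this
  omega

lemma unit_cases (w w' : OO) (h : w * w' = 1) : w.im = 0 ∨ w.re = 0 := by
  set m := w * star w' with hm
  have hs : star w * star w' = 1 := by rw [← star_mul', h, star_one]
  have h1 : m * star m = 1 := by
    rw [hm, star_mul', star_star]
    linear_combination (star w * star w') * h + hs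
  have h2 : m * star w = w := by
    rw [hm]; linear_combination w * hs
  obtain ⟨x, y⟩ := w
  obtain ⟨p, q⟩ := m
  have h4 : p ^ 2 + q ^ 2 = 1 := by
    have := congrArg QuadraticAlgebra.re h1
    simp only [re_mul, re_star, im_star, re_one] at this
    linear_combination this
  simp only [QuadraticAlgebra.ext_iff (R := ZZ), re_mul, im_mul, re_star, im_star] at h2
  obtain ⟨e1, e2⟩ := h2
  rcases sum_sq_one p q h4 with ⟨rfl, rfl⟩ | ⟨rfl, rfl⟩ | ⟨rfl, rfl⟩ | ⟨rfl, rfl⟩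
  · left; exact two_cancel y (by linear_combination -e2)
  · right; exact two_cancel x (by linear_combination -e1)
  · exfalso
    have hx : x = y := by linear_combination -e1
    subst hx
    refine not_unit ⟨x, 0⟩ w' ?_
    rw [← h]; congr 1; ext1 <;> simp
  · exfalso
    have hx : x = -y := by linear_combination -e1
    subst hx
    refine not_unit ⟨0, y⟩ w' ?_
    rw [← h]; congr 1; ext1 <;> simp

/-- `i` -/
abbrev ii : OO := ⟨0, 1⟩
/-- `√5` -/
abbrev dd : ZZ := ⟨-1, 2⟩

lemma key (a b d : OO) (h : (2 * a ^ 2 + 2 * a * b + 3 * b ^ 2) * d = 1) : False := by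
  have hi : ii * ii = -1 := by ext1 <;> simp
  set ph : OO := ⟨⟨0, 1⟩, 0⟩ with hph
  have hp : ph * ph = ph + 1 := by
    ext1
    · simp only [hph, re_mul, re_add, re_one]; ext <;> simp
    · simp [hph]
  set u : OO := (1 - ii) * a + (ph + ii * (ph - 1)) * b with hu
  set v : OO := (1 + ii) * a + (ph - ii * (ph - 1)) * b with hv
  have huv : u * v = 2 * a ^ 2 + 2 * a * b + 3 * b ^ 2 := by
    rw [hu, hv]
    generalize ii = i at *
    clear_value ph
    linear_combination (-a^2 + 2*a*b*(ph-1) - b^2 * (ph-1)^2) * hi + 2 * b^2 * hp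
  have hu1 : u * (v * d) = 1 := by rw [← mul_assoc, huv, h]
  have hw : (v * (v * d)) * (u * (u * d)) = 1 := by
    linear_combination (u * v * d + 1) * hu1
  have hvu : v = ii * u + (2 * ph - 1) * (1 - ii) * b := by
    rw [hu, hv]
    generalize ii = i at *
    clear_value ph
    linear_combination (a + b * (1 - ph)) * hi
  set c := b * (v * d) with hc
  have hwc : v * (v * d) = ii + (2 * ph - 1) * (1 - ii) * c := by
    rw [hc]; linear_combination (v * d) * hvu + ii * hu1
  have huc : 1 = (1 - ii) * (a * (v * d)) + (ph + ii * (ph - 1)) * c := by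
    rw [hc]; linear_combination -hu1 + (v * d) * hu
  have key2 : ∀ x : OO, (1 - ii) * x = 1 → False := by
    intro x hx
    refine not_unit (-ii * x) 1 ?_
    have : (⟨1, 1⟩ : OO) = 1 + ii := by ext1 <;> simp
    rw [this]; linear_combination hx - x * hi
  rw [hwc] at hw
  obtain ⟨c0, c1⟩ := c
  have hph2 : (2 * ph - 1 : OO) = ⟨dd, 0⟩ := by
    ext1
    · simp only [hph, re_mul, re_sub, re_one]; ext <;> simp
    · simp [hph]
  have hform : ii + (2 * ph - 1) * (1 - ii) * ⟨c0, c1⟩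
      = (⟨dd * (c0 + c1), 1 + dd * (c1 - c0)⟩ : OO) := by
    rw [hph2]
    generalize dd = e
    ext1 <;> simp <;> ring
  rw [hform] at hw
  rcases unit_cases _ _ hw with h0 | h0
  · -- 1 + √5 (c1 - c0) = 0
    simp only at h0
    generalize c1 - c0 = e at h0
    simp only [QuadraticAlgebra.ext_iff, re_add, im_add, re_mul, im_mul, re_one, im_one, re_zero,
      im_zero] at h0
    omega
  · simp only at h0
    have hcc : c0 + c1 = 0 := by
      generalize c0 + c1 = e at h0
      simp only [QuadraticAlgebra.ext_iff, re_mul, im_mul, re_zero, im_zero] at h0 ⊢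
      omega
    have : c1 = -c0 := by linear_combination hcc
    subst this
    have e1 : (⟨c0, -c0⟩ : OO) = (1 - ii) * ⟨c0, 0⟩ := by
      ext1 <;> simp
    rw [e1] at huc
    exact key2 (a * (v * d) + (ph + ii * (ph - 1)) * ⟨c0, 0⟩) (by linear_combination -huc)

/-! ### integers in `LL` -/

lemma rat_int (q : ℚ) (h : IsIntegral ℤ q) : ∃ n : ℤ, q = n := by
  obtain ⟨n, hn⟩ := IsIntegrallyClosed.isIntegral_iff.mp h
  exact ⟨n, by simpa using hn.symm⟩

lemma int_of_C {R : Type} [CommRing R] {a b : R} (x : R)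
    (h : IsIntegral ℤ (⟨x, 0⟩ : QuadraticAlgebra R a b)) : IsIntegral ℤ x := by
  have : (⟨x, 0⟩ : QuadraticAlgebra R a b) = algebraMap R _ x := rfl
  rw [this] at h
  exact (isIntegral_algebraMap_iff algebraMap_injective).mp h

lemma star_int {R : Type} [CommRing R] {a b : R} (x : QuadraticAlgebra R a b)
    (h : IsIntegral ℤ x) : IsIntegral ℤ (star x) :=
  map_isIntegral_int (starRingEnd (QuadraticAlgebra R a b)) h

lemma trace_int {R : Type} [CommRing R] {a b : R} (x : QuadraticAlgebra R a b)
    (h : IsIntegral ℤ x) : IsIntegral ℤ (2 * x.re + b * x.im) := by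
  apply int_of_C (a := a) (b := b)
  convert h.add (star_int x h) using 1
  ext <;> simp; ring

lemma norm_int {R : Type} [CommRing R] {a b : R} (x : QuadraticAlgebra R a b)
    (h : IsIntegral ℤ x) : IsIntegral ℤ (x.re ^ 2 + b * x.re * x.im - a * x.im ^ 2) := by
  apply int_of_C (a := a) (b := b)
  convert h.mul (star_int x h) using 1
  ext <;> simp <;> ring

lemma FF_int (x : FF) (h : IsIntegral ℤ x) : ∃ m n : ℤ, x = ⟨m, n⟩ := by
  have hw : IsIntegral ℤ (⟨0, 1⟩ : FF) := by
    refine ⟨X ^ 2 - X - 1, by monicity!, ?_⟩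
    simp only [eval₂_sub, eval₂_X_pow, eval₂_X, eval₂_one]
    ext <;> simp [pow_two]
  obtain ⟨t, ht⟩ := rat_int _ (trace_int x h)
  obtain ⟨s, hs⟩ := rat_int _ (trace_int _ (h.mul hw))
  obtain ⟨k, hk⟩ := rat_int _ (norm_int x h)
  obtain ⟨p, q⟩ := x
  simp only [re_mul, im_mul] at ht hs hk
  have h5 : 5 * q = ((2 * s - t : ℤ) : ℚ) := by push_cast; linarith
  have h6 : ((2 * s - t : ℤ) : ℚ) ^ 2 = ((5 * (k - s ^ 2 + s * (2 * s - t)) : ℤ) : ℚ) := by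
    rw [← h5]
    push_cast
    rw [← ht, ← hs, ← hk]; ring
  have h7 : (2 * s - t) ^ 2 = 5 * (k - s ^ 2 + s * (2 * s - t)) := by exact_mod_cast h6
  have h8 : (5 : ℤ) ∣ 2 * s - t := Int.Prime.dvd_pow' (by norm_num) (Dvd.intro _ h7.symm)
  obtain ⟨n, hn⟩ := h8
  rw [hn] at h5
  have hq : q = n := by push_cast at h5; linarith
  exact ⟨s - 3 * n, n, by ext <;> simp <;> linarith⟩

lemma parity (x0 x1 y0 y1 k l : ℤ) (h1 : x0 ^ 2 + x1 ^ 2 + y0 ^ 2 + y1 ^ 2 = 4 * k)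
    (h2 : 2 * x0 * x1 + x1 ^ 2 + 2 * y0 * y1 + y1 ^ 2 = 4 * l) :
    2 ∣ x0 ∧ 2 ∣ x1 ∧ 2 ∣ y0 ∧ 2 ∣ y1 := by
  have g1 := congrArg (Int.cast : ℤ → ZMod 4) h1
  have g2 := congrArg (Int.cast : ℤ → ZMod 4) h2
  have h4 : (4 : ZMod 4) = 0 := rfl
  push_cast at g1 g2
  rw [h4, zero_mul] at g1 g2
  have main : ∀ a b c d : ZMod 4, a ^ 2 + b ^ 2 + c ^ 2 + d ^ 2 = 0 →
      2 * a * b + b ^ 2 + 2 * c * d + d ^ 2 = 0 →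
      2 * a = 0 ∧ 2 * b = 0 ∧ 2 * c = 0 ∧ 2 * d = 0 := by decide
  have conv : ∀ x : ℤ, (2 : ZMod 4) * x = 0 → 2 ∣ x := by
    intro x hx
    have : ((2 * x : ℤ) : ZMod 4) = 0 := by push_cast; exact hx
    have := (ZMod.intCast_zmod_eq_zero_iff_dvd _ 4).mp this
    omega
  obtain ⟨a, b, c, d⟩ := main _ _ _ _ g1 g2
  exact ⟨conv _ a, conv _ b, conv _ c, conv _ d⟩

/-- inclusion of `ZZ` in `FF` -/
def jF : ZZ →+* FF where
  toFun x := ⟨x.re, x.im⟩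
  map_one' := by ext <;> simp
  map_zero' := by ext <;> simp
  map_add' x y := by ext <;> simp
  map_mul' x y := by ext <;> simp

lemma jF_inj : Function.Injective jF := by
  intro x y h
  simp only [jF, RingHom.coe_mk, MonoidHom.coe_mk, OneHom.coe_mk, QuadraticAlgebra.ext_iff] at h
  ext
  · exact_mod_cast h.1
  · exact_mod_cast h.2

/-- inclusion of `OO` in `LL` -/
def jL : OO →+* LL where
  toFun x := ⟨jF x.re, jF x.im⟩
  map_one' := by ext1 <;> simp
  map_zero' := by ext1 <;> simp
  map_add' x y := by ext1 <;> simp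
  map_mul' x y := by ext1 <;> simp

lemma jL_inj : Function.Injective jL := by
  intro x y h
  simp only [jL, RingHom.coe_mk, MonoidHom.coe_mk, OneHom.coe_mk, QuadraticAlgebra.ext_iff (R := FF)] at h
  ext1
  · exact jF_inj h.1
  · exact jF_inj h.2

lemma LL_int (z : LL) (h : IsIntegral ℤ z) : ∃ w : OO, jL w = z := by
  have hw : IsIntegral ℤ (⟨0, 1⟩ : LL) := by
    refine ⟨X ^ 2 + 1, by monicity!, ?_⟩
    simp only [eval₂_add, eval₂_X_pow, eval₂_one]
    ext1 <;> simp [pow_two]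
  obtain ⟨x0, x1, hx⟩ := FF_int _ (trace_int z h)
  obtain ⟨y0, y1, hy⟩ := FF_int _ (trace_int _ (h.mul hw))
  obtain ⟨k, l, hk⟩ := FF_int _ (norm_int z h)
  obtain ⟨⟨p0, p1⟩, ⟨q0, q1⟩⟩ := z
  simp [QuadraticAlgebra.ext_iff, pow_two] at hx hy hk
  obtain ⟨hx0, hx1⟩ := hx
  obtain ⟨hy0, hy1⟩ := hy
  obtain ⟨hk0, hk1⟩ := hk
  obtain ⟨⟨a, ha⟩, ⟨b, hb⟩, ⟨c, hc⟩, ⟨d, hd⟩⟩ := parity x0 x1 y0 y1 k l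
    (by have : (x0 ^ 2 + x1 ^ 2 + y0 ^ 2 + y1 ^ 2 : ℚ) = 4 * k := by
          rw [← hx0, ← hx1, ← hy0, ← hy1, ← hk0]; ring
        exact_mod_cast this)
    (by have : (2 * x0 * x1 + x1 ^ 2 + 2 * y0 * y1 + y1 ^ 2 : ℚ) = 4 * l := by
          rw [← hx0, ← hx1, ← hy0, ← hy1, ← hk1]; ring
        exact_mod_cast this)
  subst ha hb hc hd
  push_cast at hx0 hx1 hy0 hy1
  refine ⟨⟨⟨a, b⟩, ⟨-c, -d⟩⟩, ?_⟩
  ext <;> simp [jL, jF] <;> linarith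

lemma irr : Irreducible (X ^ 4 + 12 * X ^ 2 + 16 : ℚ[X]) := by
  have hm : (X ^ 4 + 12 * X ^ 2 + 16 : ℚ[X]).Monic := by monicity!
  have hd : (X ^ 4 + 12 * X ^ 2 + 16 : ℚ[X]).natDegree = 4 := by compute_degree!
  rw [hm.irreducible_iff_natDegree', hd]
  refine ⟨fun h => by rw [h] at hd; simp at hd, ?_⟩
  intro f g hf hg hfg hmem
  have hdeg : f.natDegree + g.natDegree = 4 := by
    rw [← hf.natDegree_mul hg, hfg, hd]
  simp only [Finset.mem_Ioc] at hmem
  have hcases : g.natDegree = 1 ∨ g.natDegree = 2 := by omega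
  rcases hcases with h1 | h2
  · have hg' := hg.as_sum
    rw [h1] at hg'
    have hx := congrArg (eval (-(g.coeff 0))) hfg
    have : eval (-(g.coeff 0)) g = 0 := by
      rw [hg']; simp
    rw [eval_mul, this, mul_zero] at hx
    simp only [eval_add, eval_mul, eval_pow, eval_X, eval_ofNat] at hx
    nlinarith [sq_nonneg (g.coeff 0), sq_nonneg (g.coeff 0 ^ 2)]
  · have hg' := hg.as_sum
    have hf' := hf.as_sum
    have h2' : f.natDegree = 2 := by omega
    rw [h2] at hg'
    rw [h2'] at hf'
    generalize g.coeff = G at hg'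
    generalize f.coeff = F at hf'
    simp only [Finset.sum_range_succ, Finset.sum_range_zero, zero_add, pow_zero, pow_one, mul_one]
      at hg' hf'
    have hev : ∀ t : ℚ, (t^2 + (F 0 + F 1 * t)) * (t^2 + (G 0 + G 1 * t)) = t^4 + 12*t^2+16 := by
      intro t
      have hx := congrArg (eval t) hfg
      rw [hf', hg'] at hx
      simpa using hx
    have e0 := hev 0
    have e1 := hev 1
    have e2 := hev (-1)
    have e3 := hev 2
    have e4 := hev (-2)
    generalize F 0 = e at *
    generalize F 1 = d at *
    generalize G 0 = c at *
    generalize G 1 = b at *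
    have c0 : e * c = 16 := by linarith
    have c3 : d + b = 0 := by linarith
    have c1 : b * e + c * d = 0 := by linarith
    have c2 : c + e + b * d = 12 := by linarith
    have hd : d = -b := by linarith
    subst hd
    have : b * (e - c) = 0 := by linarith
    rcases mul_eq_zero.mp this with hb | hec
    · subst hb
      have h80 : (c - e) ^ 2 = 80 := by
        have : c + e = 12 := by linarith
        linear_combination (c + e + 12) * this - 4 * c0
      have h5 : ((c - e) / 4) ^ 2 = 5 := by linarith
      have hsq : IsSquare ((5 : ℕ) : ℚ) := ⟨(c - e) / 4, by push_cast; linarith⟩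
      rw [Rat.isSquare_natCast_iff] at hsq
      obtain ⟨r, hr⟩ := hsq
      have : r ≤ 2 := by nlinarith
      interval_cases r <;> omega
    · have hec : e = c := by linarith
      subst hec
      have : (e - 4) * (e + 4) = 0 := by linarith
      rcases mul_eq_zero.mp this with h | h <;> nlinarith [sq_nonneg b]

lemma exists_hom : ∃ f : AdjoinRoot (X ^ 4 + 12 * X ^ 2 + 16 : ℚ[X]) →+* LL, True := by
  refine ⟨AdjoinRoot.lift (algebraMap ℚ LL) ⟨0, ⟨-2, 2⟩⟩ ?_, trivial⟩
  simp only [eval₂_add, eval₂_mul, eval₂_X_pow, eval₂_ofNat]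
  have h : (⟨0, ⟨-2, 2⟩⟩ : LL) ^ 2 = ⟨⟨-8, 4⟩, 0⟩ := by
    rw [pow_two]; ext <;> simp <;> norm_num
  rw [show (4 : ℕ) = 2 * 2 from rfl, pow_mul, h]
  ext <;> simp [pow_two] <;> norm_num

end HCF

theorem not_conjugate_over_hilbert_class_field :
    Irreducible (X ^ 4 + 12 * X ^ 2 + 16 : ℚ[X]) ∧
    ¬ ∃ C : Matrix (Fin 2) (Fin 2) ringOfIntegersK1,
      IsUnit C.det ∧
        (!![0, 1; -5, 0] : Matrix (Fin 2) (Fin 2) ℤ).map (Int.cast : ℤ → ringOfIntegersK1) * C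
          = C * (!![-1, 2; -3, 1] : Matrix (Fin 2) (Fin 2) ℤ).map
              (Int.cast : ℤ → ringOfIntegersK1) := by
  refine ⟨HCF.irr, ?_⟩
  rintro ⟨C, hu, hC⟩
  obtain ⟨f, -⟩ := HCF.exists_hom
  let F : ringOfIntegersK1 →+* HCF.LL :=
    f.comp (integralClosure ℤ (AdjoinRoot (X ^ 4 + 12 * X ^ 2 + 16 : ℚ[X]))).val.toRingHom
  have hF : ∀ x, ∃ w : HCF.OO, HCF.jL w = F x := by
    intro x
    apply HCF.LL_int
    exact map_isIntegral_int f x.2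
  obtain ⟨D, hD⟩ := hu.exists_right_inv
  have h00 := congrFun (congrFun hC 0) 0
  have h01 := congrFun (congrFun hC 0) 1
  simp [Matrix.mul_apply, Fin.sum_univ_two] at h00 h01
  rw [Matrix.det_fin_two, h00, h01] at hD
  obtain ⟨a, ha⟩ := hF (C 0 0)
  obtain ⟨b, hb⟩ := hF (C 0 1)
  obtain ⟨d, hd⟩ := hF D
  apply HCF.key a b d
  apply HCF.jL_inj
  have := congrArg F hD
  simp only [map_mul, map_add, map_sub, map_neg, map_one, map_pow, map_ofNat, ← ha, ← hb, ← hd]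
    at this ⊢
  linear_combination this
end

section
/- The polynomial g = x⁴ − 12x³ + 158x² + 228x + 3721 is irreducible over ℚ; let F = ℚ[x]/(g) and let R be the ring of integers of F (the integral closure of ℤ in F). Then the matrices A = [[0, 1], [−5, 0]] and B = [[−1, 2], [−3, 1]] are R-conjugate: there exists C ∈ R^{2×2} with det C a unit of R and A·C = C·B. (F is a subfield of the ray class field of ℚ(√−5) with modulus 3·O_K, and R solves the conjugacy extension problem for these matrices.) -/
open Polynomial

/-- The ring of integers (integral closure of `ℤ`) of `F = ℚ[x]/(x⁴ − 12x³ + 158x² + 228x + 3721)`,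
a subfield of the ray class field of `ℚ(√-5)` with modulus `3·O_K`. -/
noncomputable def ringOfIntegersF : Type :=
  ↥(integralClosure ℤ (AdjoinRoot (X ^ 4 - 12 * X ^ 3 + 158 * X ^ 2 + 228 * X + 3721 : ℚ[X])))

noncomputable instance : CommRing ringOfIntegersF :=
  inferInstanceAs (CommRing
    ↥(integralClosure ℤ (AdjoinRoot (X ^ 4 - 12 * X ^ 3 + 158 * X ^ 2 + 228 * X + 3721 : ℚ[X]))))

lemma irrZ_aux : Irreducible (X ^ 4 - 12 * X ^ 3 + 158 * X ^ 2 + 228 * X + 3721 : ℤ[X]) := by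
  have hm : (X ^ 4 - 12 * X ^ 3 + 158 * X ^ 2 + 228 * X + 3721 : ℤ[X]).Monic := by monicity!
  have hd : (X ^ 4 - 12 * X ^ 3 + 158 * X ^ 2 + 228 * X + 3721 : ℤ[X]).natDegree = 4 := by
    compute_degree!
  rw [hm.irreducible_iff_natDegree', hd]
  refine ⟨by intro h; rw [h] at hd; simp at hd, ?_⟩
  intro f g hf hg hfg hdeg
  have hsum : f.natDegree + g.natDegree = 4 := by rw [← hf.natDegree_mul hg, hfg, hd]
  have hev : ∀ x : ℤ, f.eval x * g.eval x = x ^ 4 - 12 * x ^ 3 + 158 * x ^ 2 + 228 * x + 3721 := by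
    intro x
    rw [← eval_mul, hfg]
    simp
  rw [Finset.mem_Ioc] at hdeg
  obtain h1 | h2 : g.natDegree = 1 ∨ g.natDegree = 2 := by omega
  · obtain ⟨a, rfl⟩ := isMonicOfDegree_one_iff.mp ⟨h1, hg⟩
    have h := hev (-a)
    simp at h
    nlinarith [sq_nonneg ((-a) ^ 2 - 6 * (-a) - 59), sq_nonneg (-a - 1), sq_nonneg ((-a) ^ 2 - 6 * (-a) + 61)]
  · obtain ⟨a, b, rfl⟩ := isMonicOfDegree_two_iff.mp ⟨h2, hg⟩
    obtain ⟨c, d, rfl⟩ := isMonicOfDegree_two_iff.mp ⟨(by omega : f.natDegree = 2), hf⟩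
    have e0 := hev 0
    have e1 := hev 1
    have e2 := hev (-1)
    have e3 := hev 2
    simp at e0 e1 e2 e3
    have k1 : a + c = -12 := by linarith
    have k3 : a * d + b * c = 228 := by linarith
    have hb : b.natAbs ∣ 61 ^ 2 := by
      have : b ∣ 3721 := ⟨d, by linarith⟩
      have := Int.natAbs_dvd_natAbs.mpr this
      simpa using this
    obtain ⟨k, hk, hbk⟩ := (Nat.dvd_prime_pow (by norm_num)).mp hb
    interval_cases k <;> rcases Int.natAbs_eq b with h | h <;> rw [hbk] at h <;> norm_num at h <;>
      subst h <;>
      (have hd2 : d = 3721 ∨ d = -3721 ∨ d = 61 ∨ d = -61 ∨ d = 1 ∨ d = -1 := by omega) <;>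
      rcases hd2 with rfl | rfl | rfl | rfl | rfl | rfl <;> omega

lemma irrQ_aux : Irreducible (X ^ 4 - 12 * X ^ 3 + 158 * X ^ 2 + 228 * X + 3721 : ℚ[X]) := by
  have hm : (X ^ 4 - 12 * X ^ 3 + 158 * X ^ 2 + 228 * X + 3721 : ℤ[X]).Monic := by monicity!
  have := (hm.irreducible_iff_irreducible_map_fraction_map (K := ℚ)).mp irrZ_aux
  simpa using this

lemma exists_omega : ∃ w : ringOfIntegersF, w ^ 2 + w + 1 = 0 := by
  set g : ℚ[X] := X ^ 4 - 12 * X ^ 3 + 158 * X ^ 2 + 228 * X + 3721 with hg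
  have hr : (AdjoinRoot.root g) ^ 4 - 12 * (AdjoinRoot.root g) ^ 3 + 158 * (AdjoinRoot.root g) ^ 2
      + 228 * (AdjoinRoot.root g) + 3721 = 0 := by
    have := AdjoinRoot.aeval_eq (f := g) g
    rw [AdjoinRoot.mk_self] at this
    conv at this => lhs; arg 2; rw [hg]
    simpa only [map_add, map_sub, map_mul, map_pow, map_ofNat, aeval_X] using this
  generalize AdjoinRoot.root g = r at hr
  have hw : ∃ w : AdjoinRoot g, w ^ 2 + w + 1 = 0 := by
    obtain ⟨u, hu⟩ : ∃ u : AdjoinRoot g, 1024 * u = 1 := by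
      refine ⟨algebraMap ℚ _ (1 / 1024), ?_⟩
      rw [← map_ofNat (algebraMap ℚ (AdjoinRoot g)) 1024, ← map_mul]
      norm_num
    refine ⟨u * (-r ^ 3 + 19 * r ^ 2 - 163 * r - 367), ?_⟩
    linear_combination u ^ 2 * (r ^ 2 - 26 * r + 217) * hr
      - (u * (-r ^ 3 + 19 * r ^ 2 - 163 * r - 367) + 1 + 1024 * u) * hu
  obtain ⟨w, hw⟩ := hw
  have hi : w ∈ integralClosure ℤ (AdjoinRoot g) := by
    refine ⟨X ^ 2 + X + 1, by monicity!, ?_⟩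
    simpa using hw
  exact ⟨⟨w, hi⟩, Subtype.ext hw⟩

/-- `g = x⁴ − 12x³ + 158x² + 228x + 3721` is irreducible over `ℚ`, and the
matrices `A = [[0,1],[-5,0]]` and `B = [[-1,2],[-3,1]]` are conjugate over the ring of
integers of `F = ℚ[x]/(g)`. -/
theorem conjugate_over_ray_class_subfield :
    Irreducible (X ^ 4 - 12 * X ^ 3 + 158 * X ^ 2 + 228 * X + 3721 : ℚ[X]) ∧
    ∃ C : Matrix (Fin 2) (Fin 2) ringOfIntegersF,
      IsUnit C.det ∧
        (!![0, 1; -5, 0] : Matrix (Fin 2) (Fin 2) ℤ).map (Int.cast : ℤ → ringOfIntegersF) * C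
          = C * (!![-1, 2; -3, 1] : Matrix (Fin 2) (Fin 2) ℤ).map
              (Int.cast : ℤ → ringOfIntegersF) := by
  refine ⟨irrQ_aux, ?_⟩
  obtain ⟨w, hw⟩ := exists_omega
  refine ⟨!![1, w; -1 - 3 * w, 2 + w], ?_, ?_⟩
  · rw [Matrix.det_fin_two_of]
    refine IsUnit.of_mul_eq_one w ?_
    linear_combination (3 * w - 1) * hw
  · ext i j
    fin_cases i <;> fin_cases j <;> simp [Matrix.mul_apply, Fin.sum_univ_two] <;> ring
end
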